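/- arXiv:2005.09717 — 4 statements merged into one kernel-verified Lean document; each statement's English description precedes it below -/
import Mathlib

section
/- Let a<b be real numbers, let T: D_cdf([a,b]) → ℝ and a nonempty convex set D ⊆ D_cdf([a,b]) satisfy the Lipschitz assumption with constant C>0, and suppose D contains H₁, H₂ such that J_τ := τH₁+(1−τ)H₂ ∈ D for every τ∈[0,1] and T(J_{τ₂})−T(J_{τ₁}) ≥ c₋(τ₂−τ₁) for some c₋>0 and all 0 ≤ τ₁ ≤ τ₂ ≤ 1. Then there exists a constant c>0, depending only on T, C, c₋, H₁, H₂ (in particular independent of K, n, and M_K), such that for every closed M_K ⊆ S_K with at least two elements, every policy π with recommendations in M_K, and any randomization measure P_G: sup over potential outcome vectors (Y_t) with independent marginals whose cdfs F¹,…,F^K all lie in {J_τ : τ∈[0,1]} of E[r_n(π, M_K)] ≥ c · diam²(M_K)/√n for every n ≥ K, where diam(M_K) := max{‖ν−γ‖ : ν,γ ∈ M_K} in the Euclidean norm. -/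
open MeasureTheory Set

noncomputable section

namespace TRDT

def IsCdfOn (a b : ℝ) (F : ℝ → ℝ) : Prop :=
  Monotone F ∧ (∀ x, ContinuousWithinAt F (Set.Ici x) x) ∧
    (∀ x, x < a → F x = 0) ∧ (∀ x, b ≤ x → F x = 1)

def supDist (F G : ℝ → ℝ) : ℝ := ⨆ x : ℝ, |F x - G x|

def LipschitzAssumption (a b : ℝ) (T : (ℝ → ℝ) → ℝ) (D : Set (ℝ → ℝ)) (C : ℝ) : Prop :=
  ∀ F ∈ D, ∀ G : ℝ → ℝ, IsCdfOn a b G → |T F - T G| ≤ C * supDist F G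

def mix {K : ℕ} (δ : Fin K → ℝ) (F : Fin K → ℝ → ℝ) : ℝ → ℝ := fun x => ∑ i, δ i * F i x

/-- The history `Z_t` of observed (outcome, randomization) pairs generated by the
assignment rules `pol`, the array `Y` of potential outcomes and the randomizations `G`:
subject `t` is assigned to treatment `pol t (Z_{t-1}) (G_t)` and its outcome is recorded. -/
def hist {K : ℕ} (pol : (t : ℕ) → (Fin t → ℝ × ℝ) → ℝ → Fin K)
    (Y : ℕ → Fin K → ℝ) (G : ℕ → ℝ) : (t : ℕ) → Fin t → ℝ × ℝ
  | 0 => Fin.elim0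
  | t + 1 => Fin.snoc (hist pol Y G t) (Y t (pol t (hist pol Y G t) (G t)), G t)

/-- Extension of a finite outcome array to all of `ℕ` (junk value `0` beyond `n`). -/
def Yext {K n : ℕ} (y : Fin n → Fin K → ℝ) : ℕ → Fin K → ℝ :=
  fun t => if h : t < n then y ⟨t, h⟩ else fun _ => 0

/-- Extension of a finite randomization sequence to all of `ℕ` (junk value `0` beyond). -/
def Gext {n : ℕ} (g : Fin n → ℝ) : ℕ → ℝ :=
  fun t => if h : t < n then g ⟨t, h⟩ else 0

/-- The expected regret `E[r_n(π, M_K)]` of the policy `(pol, polrec)` when the potential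
outcome vectors are i.i.d. with independent coordinates, the `i`-th having law `μ i`, and
the randomizations are i.i.d. with law `PG`. -/
def expectedRegret {K : ℕ} (n : ℕ) (T : (ℝ → ℝ) → ℝ) (M : Set (Fin K → ℝ))
    (pol : (t : ℕ) → (Fin t → ℝ × ℝ) → ℝ → Fin K)
    (polrec : (Fin n → ℝ × ℝ) → ℝ → (Fin K → ℝ))
    (F : Fin K → ℝ → ℝ) (μ : Fin K → ProbabilityMeasure ℝ) (PG : ProbabilityMeasure ℝ) : ℝ :=
  ∫ ω : (Fin n → Fin K → ℝ) × (Fin (n + 1) → ℝ),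
      (sSup ((fun δ => T (mix δ F)) '' M)
        - T (mix (polrec (hist pol (Yext ω.1) (Gext ω.2) n) (ω.2 (Fin.last n))) F))
    ∂((Measure.pi fun _ : Fin n => Measure.pi fun i : Fin K => (μ i : Measure ℝ)).prod
        (Measure.pi fun _ : Fin (n + 1) => (PG : Measure ℝ)))

/-- The squared (Euclidean) diameter `diam²(M_K) = max{‖ν-γ‖² : ν,γ ∈ M_K}`. -/
def diamSq {K : ℕ} (M : Set (Fin K → ℝ)) : ℝ :=
  sSup {x : ℝ | ∃ ν ∈ M, ∃ γ ∈ M, x = ∑ i, (ν i - γ i) ^ 2}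


lemma pi_wd {ι : Type*} [Fintype ι] {E : ι → Type*} [∀ i, MeasurableSpace (E i)]
    (l : ∀ i, Measure (E i)) [∀ i, IsProbabilityMeasure (l i)] (f : ∀ i, E i → ℝ)
    (h0 : ∀ i x, 0 ≤ f i x) (hi : ∀ i, Integrable (f i) (l i)) :
    Measure.pi (fun i => (l i).withDensity (fun x => ENNReal.ofReal (f i x)))
      = (Measure.pi l).withDensity (fun x => ENNReal.ofReal (∏ i, f i (x i))) := by
  have : ∀ i, IsFiniteMeasure ((l i).withDensity (fun x => ENNReal.ofReal (f i x))) :=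
    fun i => isFiniteMeasure_withDensity_ofReal (hi i).2

  refine Measure.pi_eq ?_
  intro s hs
  rw [withDensity_apply _ (MeasurableSet.univ_pi hs), Measure.restrict_pi_pi,
    ← ofReal_integral_eq_lintegral_ofReal, integral_fintype_prod_eq_prod,
    ENNReal.ofReal_prod_of_nonneg]
  · refine Finset.prod_congr rfl fun i _ => ?_
    rw [withDensity_apply _ (hs i), ofReal_integral_eq_lintegral_ofReal (hi i).restrict]
    exact ae_of_all _ (h0 i)
  · intro i _
    exact integral_nonneg (h0 i)
  · exact Integrable.fintype_prod_dep (fun i => (hi i).restrict)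
  · exact ae_of_all _ fun x => Finset.prod_nonneg fun i _ => h0 i _

lemma exists_base (a b : ℝ) (H1 H2 : ℝ → ℝ)
    (h1 : Monotone H1 ∧ (∀ x, ContinuousWithinAt H1 (Set.Ici x) x) ∧
    (∀ x, x < a → H1 x = 0) ∧ (∀ x, b ≤ x → H1 x = 1))
    (h2 : Monotone H2 ∧ (∀ x, ContinuousWithinAt H2 (Set.Ici x) x) ∧
    (∀ x, x < a → H2 x = 0) ∧ (∀ x, b ≤ x → H2 x = 1)) :
    ∃ (l : Measure ℝ) (h : ℝ → ℝ), IsProbabilityMeasure l ∧ Measurable h ∧ (∀ x, |h x| ≤ 1) ∧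
      ∫ x, h x ∂l = 0 ∧ (∀ y, l.real (Iic y) = (H1 y + H2 y) / 2) ∧
      ∀ y, ∫ x in Iic y, h x ∂l = (H1 y - H2 y) / 2 := by
  have key : ∀ H : ℝ → ℝ, (Monotone H ∧ (∀ x, ContinuousWithinAt H (Set.Ici x) x) ∧
    (∀ x, x < a → H x = 0) ∧ (∀ x, b ≤ x → H x = 1)) →
    ∃ m : Measure ℝ, IsProbabilityMeasure m ∧ ∀ y, m.real (Iic y) = H y := by
    rintro H ⟨hm, hc, ha, hb⟩
    let S : StieltjesFunction ℝ := ⟨H, hm, hc⟩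
    have hbot : Filter.Tendsto S Filter.atBot (nhds 0) := by
      refine tendsto_const_nhds.congr' ?_
      filter_upwards [Filter.eventually_lt_atBot a] with x hx
      exact (ha x hx).symm
    have htop : Filter.Tendsto S Filter.atTop (nhds 1) := by
      refine tendsto_const_nhds.congr' ?_
      filter_upwards [Filter.eventually_ge_atTop b] with x hx
      exact (hb x hx).symm
    refine ⟨S.measure, S.isProbabilityMeasure hbot htop, fun y => ?_⟩
    rw [measureReal_def, S.measure_Iic hbot, ENNReal.toReal_ofReal]
    · simp [S]
    · have : 0 ≤ H y := by
        rw [← ha (min y (a-1)) (by have := min_le_right y (a-1); linarith)]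
        exact hm (min_le_left _ _)
      simpa [S] using this
  obtain ⟨m1, hp1, hm1⟩ := key H1 h1
  obtain ⟨m2, hp2, hm2⟩ := key H2 h2
  set S := m1 + m2 with hS
  have hle : m1 ≤ S := Measure.le_add_right le_rfl
  have hac : m1 ≪ S := Measure.absolutelyContinuous_of_le hle
  have h1le := Measure.rnDeriv_le_one_of_le hle
  let r : ℝ → ℝ := fun x => min ((m1.rnDeriv S x).toReal) 1
  have hrm : Measurable r := ((Measure.measurable_rnDeriv _ _).ennreal_toReal).min measurable_const
  have hr0 : ∀ x, 0 ≤ r x := fun x => le_min ENNReal.toReal_nonneg zero_le_one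
  have hr1 : ∀ x, r x ≤ 1 := fun x => min_le_right _ _
  have hre : r =ᵐ[S] fun x => (m1.rnDeriv S x).toReal := by
    filter_upwards [h1le] with x hx
    refine min_eq_left ?_
    simpa using ENNReal.toReal_mono ENNReal.one_ne_top hx
  have hint : ∀ A, ∫ x in A, (2 * r x - 1) ∂S = m1.real A - m2.real A := by
    intro A
    have hri : Integrable r (S.restrict A) :=
      (Integrable.of_bound (C := 1) hrm.aestronglyMeasurable
        (ae_of_all _ fun x => by rw [Real.norm_eq_abs, abs_of_nonneg (hr0 x)]; exact hr1 x))
    rw [integral_sub (hri.const_mul 2) (integrable_const _), integral_const_mul,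
      integral_congr_ae (ae_restrict_of_ae hre), Measure.setIntegral_toReal_rnDeriv hac]
    simp [hS, measureReal_add_apply]
    ring
  have hint' : ∀ A, ∫ x in A, (2 * r x - 1) ∂((1/2 : ENNReal) • S) = (m1.real A - m2.real A)/2 := by
    intro A
    rw [Measure.restrict_smul, integral_smul_measure, hint]
    simp; ring
  refine ⟨(1/2 : ENNReal) • S, fun x => 2 * r x - 1, ⟨?_⟩, by fun_prop, ?_, ?_, ?_, ?_⟩
  · simp [hS]
    exact ENNReal.inv_two_add_inv_two
  · intro x
    rw [abs_le]
    constructor <;> linarith [hr0 x, hr1 x]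
  · have := hint' univ
    simpa using this
  · intro y
    rw [measureReal_ennreal_smul_apply, hS, measureReal_add_apply, hm1, hm2]
    simp; ring
  · intro y
    rw [hint', hm1, hm2]

lemma tv_bound (l : Measure ℝ) [IsProbabilityMeasure l] (h : ℝ → ℝ) (hm : Measurable h)
    (hb : ∀ x, |h x| ≤ 1) (h0 : ∫ x, h x ∂l = 0) (K n : ℕ) (s : Fin K → ℝ)
    (hs : ∀ i, |s i| ≤ 1/2) (hsum : (n : ℝ) * ∑ i, s i ^ 2 ≤ 1/128)
    {Γ : Type*} [MeasurableSpace Γ] (R : Measure Γ) [IsProbabilityMeasure R]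
    (φ : (Fin n → Fin K → ℝ) × Γ → ℝ) (hφ : Measurable φ) (hφ0 : ∀ x, 0 ≤ φ x)
    (hφ1 : ∀ x, φ x ≤ 1) :
    |∫ x, φ x ∂((Measure.pi fun _ : Fin n => Measure.pi fun i : Fin K =>
        l.withDensity (fun x => ENNReal.ofReal (1 + 2 * s i * h x))).prod R)
      - ∫ x, φ x ∂((Measure.pi fun _ : Fin n => Measure.pi fun _ : Fin K => l).prod R)| ≤ 1/4 := by
  have hsh : ∀ i x, |s i * h x| ≤ 1/2 := fun i x => by
    rw [abs_mul]
    nlinarith [hs i, hb x, abs_nonneg (s i), abs_nonneg (h x)]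
  have f0 : ∀ i x, 0 ≤ 1 + 2 * s i * h x := fun i x => by
    have := abs_le.1 (hsh i x)
    linarith [this.1]
  have f2 : ∀ i x, 1 + 2 * s i * h x ≤ 2 := fun i x => by
    have := abs_le.1 (hsh i x)
    linarith [this.2]
  have hhi : Integrable h l := Integrable.of_bound (C := 1) hm.aestronglyMeasurable (ae_of_all _ hb)
  have hh2 : Integrable (fun x => h x ^ 2) l :=
    Integrable.of_bound (C := 1) (hm.pow_const 2).aestronglyMeasurable
      (ae_of_all _ fun x => by
        rw [Real.norm_eq_abs, abs_pow]; exact pow_le_one₀ (abs_nonneg _) (hb x))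
  have hfi : ∀ i, Integrable (fun x => 1 + 2 * s i * h x) l := fun i =>
    (integrable_const _).add (hhi.const_mul _)
  have hfint : ∀ i, ∫ x, (1 + 2 * s i * h x) ∂l = 1 := fun i => by
    rw [integral_add (integrable_const _) (hhi.const_mul _), integral_const_mul, h0]; simp
  let p : (Fin n → Fin K → ℝ) → ℝ := fun y => ∏ t, ∏ i, (1 + 2 * s i * h (y t i))
  have hpm : Measurable p := by fun_prop
  have hp0 : ∀ y, 0 ≤ p y := fun y =>
    Finset.prod_nonneg fun t _ => Finset.prod_nonneg fun i _ => f0 _ _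
  have hpB : ∀ y, p y ≤ ∏ t : Fin n, ∏ i : Fin K, (2:ℝ) := fun y =>
    Finset.prod_le_prod (fun t _ => Finset.prod_nonneg fun i _ => f0 _ _)
      fun t _ => Finset.prod_le_prod (fun i _ => f0 _ _) fun i _ => f2 _ _
  set B := ∏ t : Fin n, ∏ i : Fin K, (2:ℝ) with hB
  set Q := (Measure.pi fun _ : Fin n => Measure.pi fun _ : Fin K => l) with hQ
  have hpi : Integrable p Q := Integrable.of_bound (C := B) hpm.aestronglyMeasurable
    (ae_of_all _ fun y => by rw [Real.norm_eq_abs, abs_of_nonneg (hp0 y)]; exact hpB y)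
  have hp2i : Integrable (fun y => p y ^ 2) Q :=
    Integrable.of_bound (C := B ^ 2) (hpm.pow_const 2).aestronglyMeasurable
    (ae_of_all _ fun y => by
      rw [Real.norm_eq_abs, abs_of_nonneg (by positivity)]
      exact pow_le_pow_left₀ (hp0 y) (hpB y) 2)
  have hP : (Measure.pi fun _ : Fin n => Measure.pi fun i : Fin K =>
        l.withDensity (fun x => ENNReal.ofReal (1 + 2 * s i * h x)))
      = Q.withDensity (fun y => ENNReal.ofReal (p y)) := by
    have e1 := pi_wd (fun _ : Fin K => l) (fun i x => 1 + 2 * s i * h x) f0 hfi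
    rw [e1]
    exact pi_wd (fun _ : Fin n => Measure.pi fun _ : Fin K => l)
      (fun _ y => ∏ i, (1 + 2 * s i * h (y i))) 
      (fun _ y => Finset.prod_nonneg fun i _ => f0 _ _)
      (fun _ => Integrable.fintype_prod_dep hfi)
  have hp1 : ∫ y, p y ∂Q = 1 := by
    simp only [p, hQ]
    rw [integral_fintype_prod_eq_prod (fun _ (y : Fin K → ℝ) => ∏ i, (1 + 2 * s i * h (y i)))]
    refine Finset.prod_eq_one fun t _ => ?_
    rw [integral_fintype_prod_eq_prod (fun i x => (1 + 2 * s i * h x))]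
    exact Finset.prod_eq_one fun i _ => hfint i
  have hp2 : ∫ y, p y ^ 2 ∂Q ≤ 32/31 := by
    have e : ∀ y, p y ^ 2 = ∏ t, ∏ i, (1 + 2 * s i * h (y t i)) ^ 2 := fun y => by
      simp only [p, Finset.prod_pow]
    simp only [e, hQ]
    rw [integral_fintype_prod_eq_prod (fun _ (y : Fin K → ℝ) => ∏ i, (1 + 2 * s i * h (y i)) ^ 2)]
    have hi : ∫ y : Fin K → ℝ, ∏ i, (1 + 2 * s i * h (y i)) ^ 2 ∂(Measure.pi fun _ : Fin K => l)
        ≤ Real.exp (4 * ∑ i, s i ^ 2) := by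
      rw [integral_fintype_prod_eq_prod (fun i x => (1 + 2 * s i * h x) ^ 2), Finset.mul_sum,
        Real.exp_sum]
      refine Finset.prod_le_prod (fun i _ => integral_nonneg fun x => sq_nonneg _) fun i _ => ?_
      have e2 : ∀ x, (1 + 2 * s i * h x) ^ 2 = 1 + ((4 * s i) * h x + (4 * s i ^ 2) * h x ^ 2) :=
        fun x => by ring
      simp only [e2]
      have i3 : Integrable (fun x => (4 * s i) * h x + (4 * s i ^ 2) * h x ^ 2) l :=
        (hhi.const_mul _).add (hh2.const_mul _)
      rw [integral_add (integrable_const _) i3, integral_add (hhi.const_mul _) (hh2.const_mul _), integral_const_mul, integral_const_mul, h0]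
      have h21 : ∫ x, h x ^ 2 ∂l ≤ 1 := by
        calc ∫ x, h x ^ 2 ∂l ≤ ∫ x, (1:ℝ) ∂l := integral_mono hh2 (integrable_const _) fun x => by
              simpa using hb x
          _ = 1 := by simp
      have := Real.add_one_le_exp (4 * s i ^ 2)
      simp
      nlinarith [sq_nonneg (s i)]
    have hexp : Real.exp (1/32) ≤ 32/31 := by
      have := Real.add_one_le_exp (-(1/32) : ℝ)
      rw [Real.exp_neg] at this
      have hpos := Real.exp_pos (1/32)
      have h3 : (31/32 : ℝ) ≤ (Real.exp (1/32))⁻¹ := by linarith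
      calc Real.exp (1/32) = ((Real.exp (1/32))⁻¹)⁻¹ := by rw [inv_inv]
        _ ≤ (31/32 : ℝ)⁻¹ := inv_anti₀ (by norm_num) h3
        _ = 32/31 := by norm_num
    rw [Finset.prod_const, Finset.card_univ, Fintype.card_fin]
    calc _ ≤ (Real.exp (4 * ∑ i, s i ^ 2)) ^ n :=
          pow_le_pow_left₀ (integral_nonneg fun x => Finset.prod_nonneg fun i _ => sq_nonneg _) hi n
      _ = Real.exp (4 * (n * ∑ i, s i ^ 2)) := by rw [← Real.exp_nat_mul]; ring_nf
      _ ≤ Real.exp (1/32) := Real.exp_le_exp.2 (by linarith)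
      _ ≤ _ := hexp
  have hQR : ∫ x, p x.1 * φ x ∂(Q.prod R) = ∫ x, φ x ∂((Q.withDensity
      (fun y => ENNReal.ofReal (p y))).prod R) := by
    rw [prod_withDensity_left (by fun_prop),
      integral_withDensity_eq_integral_toReal_smul (by fun_prop) (ae_of_all _ fun _ => by simp)]
    refine integral_congr_ae (ae_of_all _ fun x => ?_)
    simp [ENNReal.toReal_ofReal (hp0 x.1)]
  rw [hP, ← hQR]
  have hφa : ∀ x, |φ x| ≤ 1 := fun x => by rw [abs_of_nonneg (hφ0 x)]; exact hφ1 x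
  have hφi : Integrable φ (Q.prod R) :=
    Integrable.of_bound (C := 1) hφ.aestronglyMeasurable (ae_of_all _ hφa)
  have hpi' : Integrable (fun x : _ × Γ => p x.1) (Q.prod R) := hpi.comp_fst R
  have hp2i' : Integrable (fun x : _ × Γ => p x.1 ^ 2) (Q.prod R) := hp2i.comp_fst R
  have hpφ : Integrable (fun x : _ × Γ => p x.1 * φ x) (Q.prod R) :=
    hpi'.mul_bdd (c := 1) hφ.aestronglyMeasurable (ae_of_all _ hφa)
  rw [← integral_sub hpφ hφi]
  have e1 : ∫ x : _ × Γ, p x.1 ∂(Q.prod R) = 1 := by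
    rw [integral_fun_fst, hp1]; simp
  have e2 : ∫ x : _ × Γ, p x.1 ^ 2 ∂(Q.prod R) ≤ 32/31 := by
    rw [integral_fun_fst (fun y => p y ^ 2)]; simpa using hp2
  calc |∫ x, (p x.1 * φ x - φ x) ∂(Q.prod R)|
      ≤ ∫ x, |p x.1 * φ x - φ x| ∂(Q.prod R) := abs_integral_le_integral_abs
    _ ≤ ∫ x, ((2 * p x.1 ^ 2 - 4 * p x.1) + 17/8) ∂(Q.prod R) := by
        refine integral_mono (hpφ.sub hφi).abs
          (((hp2i'.const_mul 2).sub (hpi'.const_mul 4)).add (integrable_const _)) fun x => ?_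
        have : |p x.1 * φ x - φ x| ≤ |p x.1 - 1| := by
          rw [← sub_one_mul, abs_mul]
          exact mul_le_of_le_one_right (abs_nonneg _) (hφa x)
        refine this.trans ?_
        show |p x.1 - 1| ≤ (2 * p x.1 ^ 2 - 4 * p x.1) + 17/8
        rw [abs_le]
        constructor <;> nlinarith [sq_nonneg (p x.1 - 1 - 1/4), sq_nonneg (p x.1 - 1 + 1/4)]
    _ ≤ 1/4 := by
        have i3 : Integrable (fun x : _ × Γ => 2 * p x.1 ^ 2 - 4 * p x.1) (Q.prod R) :=
          (hp2i'.const_mul 2).sub (hpi'.const_mul 4)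
        rw [integral_add i3 (integrable_const _),
          integral_sub (hp2i'.const_mul 2) (hpi'.const_mul 4), integral_const_mul,
          integral_const_mul, e1]
        simp
        linarith

lemma measurable_Yext {K n : ℕ} (t : ℕ) :
    Measurable fun y : Fin n → Fin K → ℝ => Yext y t := by
  unfold Yext
  by_cases h : t < n
  · simp only [h, dif_pos]; fun_prop
  · simp only [h, dif_neg, not_false_eq_true]; fun_prop

lemma measurable_Gext {n : ℕ} (t : ℕ) :
    Measurable fun g : Fin n → ℝ => Gext g t := by
  unfold Gext
  by_cases h : t < n
  · simp only [h, dif_pos]; fun_prop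
  · simp only [h, dif_neg, not_false_eq_true]; fun_prop

lemma measurable_hist {K n m : ℕ} (pol : (t : ℕ) → (Fin t → ℝ × ℝ) → ℝ → Fin K)
    (hpol : ∀ t, Measurable fun p : (Fin t → ℝ × ℝ) × ℝ => pol t p.1 p.2) (t : ℕ) :
    Measurable fun ω : (Fin n → Fin K → ℝ) × (Fin m → ℝ) =>
      hist pol (Yext ω.1) (Gext ω.2) t := by
  induction t with
  | zero => exact measurable_pi_iff.2 fun i => i.elim0
  | succ t ih =>
    have hG : Measurable fun ω : (Fin n → Fin K → ℝ) × (Fin m → ℝ) => Gext ω.2 t :=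
      (measurable_Gext t).comp measurable_snd
    have hY : Measurable fun ω : (Fin n → Fin K → ℝ) × (Fin m → ℝ) => Yext ω.1 t :=
      (measurable_Yext t).comp measurable_fst
    have hA : Measurable fun ω : (Fin n → Fin K → ℝ) × (Fin m → ℝ) =>
        pol t (hist pol (Yext ω.1) (Gext ω.2) t) (Gext ω.2 t) := (hpol t).comp (ih.prodMk hG)
    have hev : Measurable fun p : Fin K × (Fin K → ℝ) => p.2 p.1 :=
      measurable_from_prod_countable_right fun x => measurable_pi_apply x
    have hO := hev.comp (hA.prodMk hY)
    refine measurable_pi_iff.2 fun i => ?_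
    refine Fin.lastCases ?_ (fun j => ?_) i
    · simp only [hist, Fin.snoc_last]
      exact hO.prodMk hG
    · simp only [hist, Fin.snoc_castSucc]
      exact (measurable_pi_apply j).comp ih

lemma regret_facts (T : (ℝ → ℝ) → ℝ) (H1 H2 : ℝ → ℝ) (cminus : ℝ) (hcminus : 0 < cminus)
    (hgrow : ∀ τ₁ τ₂ : ℝ, 0 ≤ τ₁ → τ₁ ≤ τ₂ → τ₂ ≤ 1 →
      cminus * (τ₂ - τ₁)
        ≤ T (fun x => τ₂ * H1 x + (1 - τ₂) * H2 x)
          - T (fun x => τ₁ * H1 x + (1 - τ₁) * H2 x))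
    {K : ℕ} (M : Set (Fin K → ℝ)) (hM : M ⊆ stdSimplex ℝ (Fin K))
    {Ω : Type*} [MeasurableSpace Ω] (q : Ω → Fin K → ℝ) (hq : Measurable q)
    (hqM : ∀ ω, q ω ∈ M) (τ : Fin K → ℝ) (hτ : ∀ i, τ i ∈ Set.Icc (0 : ℝ) 1)
    (r : Ω → ℝ) (hr : r = fun ω =>
      (sSup ((fun δ => T (mix δ (fun i z => τ i * H1 z + (1 - τ i) * H2 z))) '' M)
        - T (mix (q ω) (fun i z => τ i * H1 z + (1 - τ i) * H2 z)))) :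
    Measurable r ∧ (∀ ω, 0 ≤ r ω) ∧
    (∀ ω, r ω ≤ T (fun x => 1 * H1 x + (1 - 1) * H2 x) - T (fun x => 0 * H1 x + (1 - 0) * H2 x)) ∧
    (∀ ω, ∀ δ ∈ M, cminus * (∑ i, δ i * τ i - ∑ i, q ω i * τ i) ≤ r ω) := by
  set g : ℝ → ℝ := fun t => T (fun x => t * H1 x + (1 - t) * H2 x) with hg
  have hgmono : ∀ s t, 0 ≤ s → s ≤ t → t ≤ 1 → g s ≤ g t := fun s t h0 h1 h2 => by
    have := hgrow s t h0 h1 h2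
    have h3 : 0 ≤ cminus * (t - s) := mul_nonneg hcminus.le (by linarith)
    simp only [hg]; linarith
  have hmix : ∀ δ ∈ M, T (mix δ (fun i z => τ i * H1 z + (1 - τ i) * H2 z))
      = g (∑ i, δ i * τ i) := by
    intro δ hδ
    simp only [hg]
    congr 1
    funext x
    have h1 : ∑ i, δ i = 1 := (hM hδ).2
    simp only [mix]
    calc _ = ∑ i, ((δ i * τ i) * H1 x + (δ i) * H2 x - (δ i * τ i) * H2 x) :=
          Finset.sum_congr rfl fun i _ => by ring
      _ = _ := by
          rw [Finset.sum_sub_distrib, Finset.sum_add_distrib, ← Finset.sum_mul, ← Finset.sum_mul,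
            ← Finset.sum_mul, h1]; ring
  have hrange : ∀ δ ∈ M, 0 ≤ ∑ i, δ i * τ i ∧ ∑ i, δ i * τ i ≤ 1 := by
    intro δ hδ
    have hd := hM hδ
    refine ⟨Finset.sum_nonneg fun i _ => mul_nonneg (hd.1 i) (hτ i).1, ?_⟩
    rw [← hd.2]
    exact Finset.sum_le_sum fun i _ => mul_le_of_le_one_right (hd.1 i) (hτ i).2
  have hub : ∀ y ∈ ((fun δ => T (mix δ (fun i z => τ i * H1 z + (1 - τ i) * H2 z))) '' M),
      y ≤ g 1 := by
    rintro _ ⟨δ, hδ, rfl⟩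
    simp only [hmix δ hδ]
    exact hgmono _ _ (hrange δ hδ).1 (hrange δ hδ).2 le_rfl
  have hle : ∀ δ ∈ M, g (∑ i, δ i * τ i) ≤
      sSup ((fun δ => T (mix δ (fun i z => τ i * H1 z + (1 - τ i) * H2 z))) '' M) := by
    intro δ hδ
    rw [← hmix δ hδ]
    exact le_csSup ⟨_, hub⟩ ⟨δ, hδ, rfl⟩
  have hr' : ∀ ω, r ω = sSup ((fun δ => T (mix δ (fun i z => τ i * H1 z + (1 - τ i) * H2 z))) '' M)
      - g (∑ i, q ω i * τ i) := fun ω => by rw [hr, ← hmix _ (hqM ω)]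
  have hr0 : ∀ ω, 0 ≤ r ω := fun ω => by
    rw [hr']; linarith [hle _ (hqM ω)]
  refine ⟨?_, hr0, ?_, ?_⟩
  · let G : ℝ → ℝ := fun x => g (max 0 (min x 1))
    have hG : Monotone G := fun x y hxy =>
      hgmono _ _ (le_max_left _ _) (max_le_max le_rfl (min_le_min hxy le_rfl))
        (max_le zero_le_one (min_le_right _ _))
    have : r = fun ω => sSup ((fun δ => T (mix δ (fun i z => τ i * H1 z + (1 - τ i) * H2 z))) '' M)
      - G (∑ i, q ω i * τ i) := by
      funext ω
      rw [hr']
      simp only [G]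
      rw [min_eq_left (hrange _ (hqM ω)).2, max_eq_right (hrange _ (hqM ω)).1]
    rw [this]
    refine measurable_const.sub (hG.measurable.comp ?_)
    fun_prop
  · intro ω
    rw [hr']
    have h1 : sSup ((fun δ => T (mix δ (fun i z => τ i * H1 z + (1 - τ i) * H2 z))) '' M) ≤ g 1 :=
      csSup_le ⟨_, _, hqM ω, rfl⟩ hub
    have h2 := hgmono 0 _ le_rfl (hrange _ (hqM ω)).1 (hrange _ (hqM ω)).2
    show _ ≤ g 1 - g 0
    linarith
  · intro ω δ hδ
    rcases le_total (∑ i, q ω i * τ i) (∑ i, δ i * τ i) with h | h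
    · have h1 := hgrow _ _ (hrange _ (hqM ω)).1 h (hrange _ hδ).2
      have h2 := hle δ hδ
      rw [hr']
      simp only [hg] at h2 ⊢
      linarith
    · exact le_trans (mul_nonpos_of_nonneg_of_nonpos hcminus.le (by linarith)) (hr0 ω)

lemma exists_laws (a b : ℝ) (H1 H2 : ℝ → ℝ) (h1 : IsCdfOn a b H1) (h2 : IsCdfOn a b H2) :
    ∃ (l : Measure ℝ) (h : ℝ → ℝ), IsProbabilityMeasure l ∧ Measurable h ∧ (∀ x, |h x| ≤ 1) ∧
      ∫ x, h x ∂l = 0 ∧ ∀ s : ℝ, |s| ≤ 1/2 →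
        ∃ μ : ProbabilityMeasure ℝ,
          (μ : Measure ℝ) = l.withDensity (fun x => ENNReal.ofReal (1 + 2 * s * h x)) ∧
          ∀ y, (μ : Measure ℝ) (Iic y) =
            ENNReal.ofReal ((1/2 + s) * H1 y + (1 - (1/2 + s)) * H2 y) := by
  obtain ⟨l, h, hl, hm, hb, h0, hI, hJ⟩ := exists_base a b H1 H2 h1 h2
  refine ⟨l, h, hl, hm, hb, h0, fun s hs => ?_⟩
  have hhi : Integrable h l := Integrable.of_bound (C := 1) hm.aestronglyMeasurable (ae_of_all _ hb)
  have f0 : ∀ x, 0 ≤ 1 + 2 * s * h x := fun x => by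
    have : |s * h x| ≤ 1/2 := by
      rw [abs_mul]
      nlinarith [hs, hb x, abs_nonneg s, abs_nonneg (h x)]
    have := abs_le.1 this
    linarith [this.1]
  have hfi : Integrable (fun x => 1 + 2 * s * h x) l := (integrable_const _).add (hhi.const_mul _)
  have hA : ∀ A, MeasurableSet A → l.withDensity (fun x => ENNReal.ofReal (1 + 2 * s * h x)) A
      = ENNReal.ofReal (l.real A + 2 * s * ∫ x in A, h x ∂l) := by
    intro A hA
    rw [withDensity_apply _ hA, ← ofReal_integral_eq_lintegral_ofReal hfi.restrict
      (ae_of_all _ f0), integral_add (integrable_const _) (hhi.restrict.const_mul _),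
      integral_const_mul]
    simp
  have hprob : IsProbabilityMeasure
      (l.withDensity (fun x => ENNReal.ofReal (1 + 2 * s * h x))) :=
    ⟨by rw [hA _ MeasurableSet.univ]; simp [h0]⟩
  refine ⟨⟨_, hprob⟩, rfl, fun y => ?_⟩
  show l.withDensity (fun x => ENNReal.ofReal (1 + 2 * s * h x)) (Iic y) = _
  rw [hA _ measurableSet_Iic, hI, hJ]
  congr 1
  ring

/-- Theorem 1 of the paper: under Assumptions 1–4 there is a constant `c > 0`
(depending only on `T`, `C`, `c₋`, `H₁`, `H₂`; in particular independent of `K`, `n` and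
`M_K`) such that for every closed `M_K ⊆ S_K` with at least two elements, every policy
with recommendations in `M_K`, and any randomization measure `P_G`,
`sup E[r_n(π, M_K)] ≥ c·diam²(M_K)/√n` for every `n ≥ K`, the supremum being over all
potential outcome vectors with independent marginals and cdfs in `{J_τ : τ ∈ [0,1]}`. -/
theorem lower_bound_diamSq
    (a b : ℝ) (hab : a < b)
    (T : (ℝ → ℝ) → ℝ) (D : Set (ℝ → ℝ)) (hDne : D.Nonempty)
    (hDcdf : ∀ F ∈ D, IsCdfOn a b F) (hDconv : Convex ℝ D)
    (C : ℝ) (hC : 0 < C) (hLip : LipschitzAssumption a b T D C)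
    (H1 H2 : ℝ → ℝ) (hH1 : H1 ∈ D) (hH2 : H2 ∈ D)
    (hJ : ∀ τ : ℝ, τ ∈ Set.Icc (0 : ℝ) 1 → (fun x => τ * H1 x + (1 - τ) * H2 x) ∈ D)
    (cminus : ℝ) (hcminus : 0 < cminus)
    (hgrow : ∀ τ₁ τ₂ : ℝ, 0 ≤ τ₁ → τ₁ ≤ τ₂ → τ₂ ≤ 1 →
      cminus * (τ₂ - τ₁)
        ≤ T (fun x => τ₂ * H1 x + (1 - τ₂) * H2 x)
          - T (fun x => τ₁ * H1 x + (1 - τ₁) * H2 x)) :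
    ∃ c : ℝ, 0 < c ∧
      ∀ (K n : ℕ), 2 ≤ K → K ≤ n →
      ∀ M : Set (Fin K → ℝ), M ⊆ stdSimplex ℝ (Fin K) → IsClosed M → M.Nontrivial →
      ∀ pol : (t : ℕ) → (Fin t → ℝ × ℝ) → ℝ → Fin K,
        (∀ t, Measurable fun p : (Fin t → ℝ × ℝ) × ℝ => pol t p.1 p.2) →
      ∀ polrec : (Fin n → ℝ × ℝ) → ℝ → (Fin K → ℝ),
        Measurable (fun p : (Fin n → ℝ × ℝ) × ℝ => polrec p.1 p.2) →
        (∀ h g, polrec h g ∈ M) →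
      ∀ PG : ProbabilityMeasure ℝ,
        c * diamSq M / Real.sqrt n ≤
          sSup {x : ℝ | ∃ (τ : Fin K → ℝ) (μ : Fin K → ProbabilityMeasure ℝ),
            (∀ i, τ i ∈ Set.Icc (0 : ℝ) 1) ∧
            (∀ (i : Fin K) (y : ℝ),
              (μ i : Measure ℝ) (Set.Iic y)
                = ENNReal.ofReal (τ i * H1 y + (1 - τ i) * H2 y)) ∧
            x = expectedRegret n T M pol polrec
                  (fun i z => τ i * H1 z + (1 - τ i) * H2 z) μ PG} := by
  obtain ⟨l, h, hl, hm, hb, h0, hlaw⟩ :=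
    exists_laws a b H1 H2 (hDcdf _ hH1) (hDcdf _ hH2)
  refine ⟨cminus / 64, by positivity, ?_⟩
  intro K n hK hKn M hM _ hMnt pol hpol polrec hrec hrecM PG
  have hn : (0:ℝ) < n := by
    have : 0 < n := by omega
    exact_mod_cast this
  have hsq : 0 < Real.sqrt n := Real.sqrt_pos.2 hn
  have hn1 : 1 ≤ Real.sqrt n := by
    rw [Real.one_le_sqrt]
    have : 1 ≤ n := by omega
    exact_mod_cast this
  set X := {x : ℝ | ∃ (τ : Fin K → ℝ) (μ : Fin K → ProbabilityMeasure ℝ),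
            (∀ i, τ i ∈ Set.Icc (0 : ℝ) 1) ∧
            (∀ (i : Fin K) (y : ℝ),
              (μ i : Measure ℝ) (Set.Iic y)
                = ENNReal.ofReal (τ i * H1 y + (1 - τ i) * H2 y)) ∧
            x = expectedRegret n T M pol polrec
                  (fun i z => τ i * H1 z + (1 - τ i) * H2 z) μ PG} with hX
  let q : (Fin n → Fin K → ℝ) × (Fin (n + 1) → ℝ) → Fin K → ℝ := fun ω =>
    polrec (hist pol (Yext ω.1) (Gext ω.2) n) (ω.2 (Fin.last n))
  have hq : Measurable q := hrec.comp ((measurable_hist pol hpol n).prodMk (by fun_prop))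
  have hqM : ∀ ω, q ω ∈ M := fun ω => hrecM _ _
  have hfacts := fun (τ : Fin K → ℝ) (hτ : ∀ i, τ i ∈ Set.Icc (0 : ℝ) 1) =>
    regret_facts T H1 H2 cminus hcminus hgrow M hM q hq hqM τ hτ _ rfl
  set Bd := T (fun x => 1 * H1 x + (1 - 1) * H2 x) - T (fun x => 0 * H1 x + (1 - 0) * H2 x)
    with hBd
  have hbdd : BddAbove X := by
    refine ⟨Bd, ?_⟩
    rintro x ⟨τ, μ, hτ, -, rfl⟩
    obtain ⟨h1, h2, h3, -⟩ := hfacts τ hτ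
    unfold expectedRegret
    refine (integral_mono (Integrable.of_bound (C := Bd) h1.aestronglyMeasurable
      (ae_of_all _ fun ω => by rw [Real.norm_eq_abs, abs_of_nonneg (h2 ω)]; exact h3 ω))
      (integrable_const Bd) h3).trans ?_
    simp
  suffices hmain : ∀ ν ∈ M, ∀ γ ∈ M,
      cminus / 64 * (∑ i, (ν i - γ i) ^ 2) / Real.sqrt n ≤ sSup X by
    have : diamSq M ≤ sSup X * Real.sqrt n / (cminus / 64) := by
      obtain ⟨ν, hν⟩ := hMnt.nonempty
      refine csSup_le ⟨_, ν, hν, ν, hν, rfl⟩ ?_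
      rintro _ ⟨ν, hν, γ, hγ, rfl⟩
      have := hmain ν hν γ hγ
      rw [div_le_iff₀ hsq] at this
      rw [le_div_iff₀ (by positivity)]
      linarith
    rw [le_div_iff₀ (by positivity)] at this
    rw [div_le_iff₀ hsq]
    linarith
  intro ν hν γ hγ
  set d : Fin K → ℝ := fun i => ν i - γ i with hd
  set Δ := ∑ i, (ν i - γ i) ^ 2 with hΔ
  set ε := 1 / (16 * Real.sqrt n) with hε
  have hε0 : 0 < ε := by positivity
  have hεn : n * ε ^ 2 = 1 / 256 := by
    rw [hε, div_pow, mul_pow, Real.sq_sqrt hn.le]; field_simp; norm_num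
  have hε1 : ε ≤ 1/16 := by
    rw [hε]
    exact one_div_le_one_div_of_le (by norm_num) (by linarith)
  have hν1 : ∀ i, ν i ≤ 1 := fun i => (mem_Icc_of_mem_stdSimplex (hM hν) i).2
  have hγ1 : ∀ i, γ i ≤ 1 := fun i => (mem_Icc_of_mem_stdSimplex (hM hγ) i).2
  have hν0 := (hM hν).1
  have hγ0 := (hM hγ).1
  have hd1 : ∀ i, |d i| ≤ 1 := fun i => by
    rw [abs_le]
    constructor <;> simp only [hd] <;> linarith [hν1 i, hγ1 i, hν0 i, hγ0 i]
  have hΔ2 : Δ ≤ 2 := by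
    have : Δ ≤ ∑ i, (ν i + γ i) := Finset.sum_le_sum fun i _ => by
      nlinarith [hν1 i, hγ1 i, hν0 i, hγ0 i, mul_nonneg (hν0 i) (hγ0 i),
        mul_nonneg (hν0 i) (sub_nonneg.2 (hν1 i)), mul_nonneg (hγ0 i) (sub_nonneg.2 (hγ1 i))]
    rw [Finset.sum_add_distrib, (hM hν).2, (hM hγ).2] at this
    linarith
  have hΔ0 : 0 ≤ Δ := Finset.sum_nonneg fun i _ => sq_nonneg _
  have hΔd : ∑ i, ν i * d i - ∑ i, γ i * d i = Δ := by
    rw [hΔ, ← Finset.sum_sub_distrib]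
    exact Finset.sum_congr rfl fun i _ => by simp only [hd]; ring
  -- test function
  let φ : (Fin n → Fin K → ℝ) × (Fin (n + 1) → ℝ) → ℝ := fun ω =>
    max 0 (min ((∑ i, ν i * d i - ∑ i, q ω i * d i) / Δ) 1)
  have hφm : Measurable φ := by
    have : Measurable fun ω => ∑ i, q ω i * d i := by fun_prop
    exact measurable_const.max (((measurable_const.sub this).div_const _).min measurable_const)
  have hφ0 : ∀ ω, 0 ≤ φ ω := fun ω => le_max_left _ _
  have hφ1 : ∀ ω, φ ω ≤ 1 := fun ω => max_le zero_le_one (min_le_right _ _)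
  have hφa : ∀ ω, ‖φ ω‖ ≤ 1 := fun ω => by
    rw [Real.norm_eq_abs, abs_of_nonneg (hφ0 ω)]; exact hφ1 ω
  have hφle : ∀ ω, Δ * φ ω ≤ max 0 (∑ i, ν i * d i - ∑ i, q ω i * d i) := by
    intro ω
    rcases hΔ0.eq_or_lt with h | h
    · rw [← h, zero_mul]; exact le_max_left _ _
    · simp only [φ]
      rw [mul_max_of_nonneg _ _ hΔ0, mul_zero]
      refine max_le_max le_rfl ((mul_le_mul_of_nonneg_left (min_le_left _ _) hΔ0).trans ?_)
      rw [mul_div_cancel₀ _ h.ne']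
  have hφge : ∀ ω, Δ * (1 - φ ω) ≤ max 0 (∑ i, q ω i * d i - ∑ i, γ i * d i) := by
    intro ω
    rcases hΔ0.eq_or_lt with h | h
    · rw [← h, zero_mul]; exact le_max_left _ _
    · have h1 : min ((∑ i, ν i * d i - ∑ i, q ω i * d i) / Δ) 1 ≤ φ ω := le_max_right _ _
      rcases le_total ((∑ i, ν i * d i - ∑ i, q ω i * d i) / Δ) 1 with h2 | h2
      · rw [min_eq_left h2, div_le_iff₀ h] at h1
        exact le_max_of_le_right (by linarith)
      · rw [min_eq_right h2] at h1
        exact le_max_of_le_left (mul_nonpos_of_nonneg_of_nonpos hΔ0 (by linarith))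
  let R : Measure (Fin (n + 1) → ℝ) := Measure.pi fun _ : Fin (n + 1) => (PG : Measure ℝ)
  set I0 := ∫ x, φ x ∂((Measure.pi fun _ : Fin n => Measure.pi fun _ : Fin K => l).prod R)
    with hI0
  -- the two alternatives, indexed by a sign
  have halt : ∀ σ : ℝ, |σ| = 1 → ∀ ψ : (Fin n → Fin K → ℝ) × (Fin (n + 1) → ℝ) → ℝ,
      Measurable ψ → (∀ ω, 0 ≤ ψ ω) → (∀ ω, ψ ω ≤ 1) → ∀ κ ∈ M,
      (∀ ω, Δ * ψ ω ≤ max 0 (σ * (∑ i, κ i * d i - ∑ i, q ω i * d i))) →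
      cminus * ε * Δ * (∫ x, ψ x ∂((Measure.pi fun _ : Fin n => Measure.pi fun _ : Fin K => l).prod R)
        - 1/4) ≤ sSup X := by
    intro σ hσ ψ hψm hψ0 hψ1 κ hκ hψ
    have hσ2 : σ ^ 2 = 1 := by rw [← sq_abs, hσ, one_pow]
    let s : Fin K → ℝ := fun i => σ * ε * d i
    have hs : ∀ i, |s i| ≤ 1/2 := fun i => by
      simp only [s, abs_mul, hσ, abs_of_pos hε0]
      nlinarith [hd1 i, abs_nonneg (d i)]
    have hssum : (n : ℝ) * ∑ i, s i ^ 2 ≤ 1/128 := by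
      have : ∑ i, s i ^ 2 = ε ^ 2 * Δ := by
        rw [hΔ, Finset.mul_sum]
        refine Finset.sum_congr rfl fun i _ => ?_
        simp only [s, hd, mul_pow, hσ2]; ring
      rw [this, ← mul_assoc, hεn]
      linarith
    choose μ hμ hμI using fun i => hlaw (s i) (hs i)
    let τ : Fin K → ℝ := fun i => 1/2 + s i
    have hτ : ∀ i, τ i ∈ Set.Icc (0:ℝ) 1 := fun i => by
      have := abs_le.1 (hs i)
      constructor <;> simp only [τ] <;> linarith [this.1, this.2]
    obtain ⟨h1, h2, h3, h4⟩ := hfacts τ hτ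
    have hmem : expectedRegret n T M pol polrec
        (fun i z => τ i * H1 z + (1 - τ i) * H2 z) μ PG ∈ X := ⟨τ, μ, hτ, hμI, rfl⟩
    refine le_trans ?_ (le_csSup hbdd hmem)
    have htv := tv_bound l h hm hb h0 K n s hs hssum R ψ hψm hψ0 hψ1
    simp only [← hμ] at htv
    have htv' := (abs_le.1 htv).1
    have hdot : ∀ δ ∈ M, ∑ i, δ i * τ i = 1/2 + σ * ε * ∑ i, δ i * d i := by
      intro δ hδ
      have e1 : ∑ i, δ i = 1 := (hM hδ).2
      calc _ = ∑ i, (δ i * (1/2) + σ * ε * (δ i * d i)) :=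
            Finset.sum_congr rfl fun i _ => by simp only [τ, s]; ring
        _ = _ := by
            rw [Finset.sum_add_distrib, ← Finset.sum_mul, ← Finset.mul_sum, e1]; ring
    calc _ ≤ cminus * ε * Δ * ∫ x, ψ x ∂((Measure.pi fun _ : Fin n =>
            Measure.pi fun i : Fin K => (μ i : Measure ℝ)).prod R) := by
          refine mul_le_mul_of_nonneg_left ?_ (by positivity)
          linarith
      _ = ∫ x, cminus * ε * Δ * ψ x ∂((Measure.pi fun _ : Fin n =>
            Measure.pi fun i : Fin K => (μ i : Measure ℝ)).prod R) := by
          rw [integral_const_mul]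
      _ ≤ _ := by
          unfold expectedRegret
          refine integral_mono ((Integrable.of_bound (C := 1) hψm.aestronglyMeasurable
            (ae_of_all _ fun ω => by
              rw [Real.norm_eq_abs, abs_of_nonneg (hψ0 ω)]; exact hψ1 ω)).const_mul _)
            (Integrable.of_bound (C := Bd) h1.aestronglyMeasurable
            (ae_of_all _ fun ω => by
              rw [Real.norm_eq_abs, abs_of_nonneg (h2 ω)]; exact h3 ω)) fun ω => ?_
          have e4 := h4 ω κ hκ
          rw [hdot κ hκ, hdot _ (hqM ω)] at e4
          have e2 := h2 ω
          rcases le_max_iff.1 (hψ ω) with e | e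
          · refine le_trans ?_ e2
            show cminus * ε * Δ * ψ ω ≤ 0
            rw [mul_assoc]
            exact mul_nonpos_of_nonneg_of_nonpos (by positivity) e
          · refine le_trans ?_ e4
            show cminus * ε * Δ * ψ ω ≤ _
            have := mul_le_mul_of_nonneg_left e (show 0 ≤ cminus * ε by positivity)
            linarith
  have hA := halt 1 (by simp) φ hφm hφ0 hφ1 ν hν (fun ω => by simpa using hφle ω)
  have hB := halt (-1) (by simp) (fun ω => 1 - φ ω) (by fun_prop) (fun ω => by linarith [hφ1 ω])
    (fun ω => by linarith [hφ0 ω]) γ hγ (fun ω => by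
      have := hφge ω
      have e : -1 * (∑ i, γ i * d i - ∑ i, q ω i * d i)
        = ∑ i, q ω i * d i - ∑ i, γ i * d i := by ring
      rw [e]; exact this)
  rw [integral_sub (integrable_const _) (Integrable.of_bound (C := 1) hφm.aestronglyMeasurable
    (ae_of_all _ hφa))] at hB
  simp only [integral_const, probReal_univ, smul_eq_mul, one_mul] at hB
  rw [← hI0] at hA hB
  have hfin : cminus / 64 * Δ / Real.sqrt n = cminus * ε * Δ * (1/4) := by
    rw [hε]; field_simp; ring
  rw [hfin]
  linarith

end TRDT
end
end

section
/- Let a<b be real numbers, let T: D_cdf([a,b]) → ℝ and a nonempty convex D ⊆ D_cdf([a,b]) satisfy the Lipschitz assumption with constant C>0, and suppose D contains H₁, H₂ such that J_τ := τH₁+(1−τ)H₂ ∈ D for every τ∈[0,1] and T(J_{τ₂})−T(J_{τ₁}) ≥ c₋(τ₂−τ₁) for some c₋>0 and all 0 ≤ τ₁ ≤ τ₂ ≤ 1. Then there exists a constant c>0, depending only on T, C, c₋, H₁, H₂ (independent of K, n, and M_K), such that for every closed M_K ⊆ S_K with at least two elements, every policy π with recommendations in M_K, and any randomization measure P_G: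 sup over potential outcome vectors with independent marginals and cdfs F¹,…,F^K in {J_τ : τ∈[0,1]} of E[r_n(π, M_K)] ≥ c · κ(M_K) · √(K/n) for every n ≥ K. -/
open MeasureTheory Set

noncomputable section

namespace TRDT

/-- The quantity `κ(M_K)` from the paper. -/
def kappa {K : ℕ} (M : Set (Fin K → ℝ)) : ℝ :=
  sSup {x : ℝ | ∃ (T : Set (Fin K → ℝ)) (v w : Fin K → ℝ),
    T.Nonempty ∧ T ⊂ M ∧ MeasurableSet T ∧
    (∀ i, v i ∈ Set.Icc (-1 : ℝ) 1) ∧ (∀ i, w i ∈ Set.Icc (-1 : ℝ) 1) ∧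
    x = min
      (sSup ((fun δ => ∑ i, v i * δ i) '' M) - sSup ((fun δ => ∑ i, v i * δ i) '' T))
      (⨅ i : Fin K,
        (sSup ((fun δ => (∑ j, v j * δ j) + w i * δ i) '' M)
          - sSup ((fun δ => (∑ j, v j * δ j) + w i * δ i) '' (M \ T))))}


section helpers

lemma measurable_snoc' {X : Type*} [MeasurableSpace X] (t : ℕ) :
    Measurable (fun p : (Fin t → X) × X => (Fin.snoc p.1 p.2 : Fin (t + 1) → X)) := by
  refine measurable_pi_iff.2 fun i => ?_
  refine Fin.lastCases ?_ (fun j => ?_) i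
  · simpa using measurable_snd
  · simp only [Fin.snoc_castSucc]
    exact (measurable_pi_apply j).comp measurable_fst

lemma mp_rearr {A B C D : Type*} [MeasurableSpace A] [MeasurableSpace B] [MeasurableSpace C]
    [MeasurableSpace D] (a : Measure A) (b : Measure B) (c : Measure C) (d : Measure D)
    [IsProbabilityMeasure a] [IsProbabilityMeasure b] [IsProbabilityMeasure c]
    [IsProbabilityMeasure d] :
    MeasurePreserving (fun p : (A × B) × (C × D) => ((p.1.1, p.2.1), (p.1.2, p.2.2)))
      ((a.prod b).prod (c.prod d)) ((a.prod c).prod (b.prod d)) := by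
  have e1 := measurePreserving_prodAssoc a b (c.prod d)
  have e2 := (MeasurePreserving.id a).prod ((measurePreserving_prodAssoc b c d).symm)
  have e3 := (MeasurePreserving.id a).prod
    ((Measure.measurePreserving_swap (μ := b) (ν := c)).prod (MeasurePreserving.id d))
  have e4 := (MeasurePreserving.id a).prod (measurePreserving_prodAssoc c b d)
  have e5 := (measurePreserving_prodAssoc a c (b.prod d)).symm
  exact e5.comp (e4.comp (e3.comp (e2.comp e1)))

variable {K : ℕ}

def stepMap (pol : (t : ℕ) → (Fin t → ℝ × ℝ) → ℝ → Fin K) (t : ℕ)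
    (p : (Fin t → ℝ × ℝ) × ((Fin K → ℝ) × ℝ)) : Fin (t + 1) → ℝ × ℝ :=
  Fin.snoc p.1 (p.2.1 (pol t p.1 p.2.2), p.2.2)

def lawQ (pol : (t : ℕ) → (Fin t → ℝ × ℝ) → ℝ → Fin K)
    (μ : Fin K → Measure ℝ) (PG : Measure ℝ) : (t : ℕ) → Measure (Fin t → ℝ × ℝ)
  | 0 => Measure.dirac Fin.elim0
  | t + 1 => Measure.map (stepMap pol t) ((lawQ pol μ PG t).prod ((Measure.pi μ).prod PG))

lemma measurable_eval2 : Measurable (fun q : (Fin K → ℝ) × Fin K => q.1 q.2) :=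
  measurable_from_prod_countable_left fun i => measurable_pi_apply i

lemma measurable_stepMap {pol : (t : ℕ) → (Fin t → ℝ × ℝ) → ℝ → Fin K}
    (hpol : ∀ t, Measurable fun p : (Fin t → ℝ × ℝ) × ℝ => pol t p.1 p.2) (t : ℕ) :
    Measurable (stepMap pol t) := by
  have h1 : Measurable fun p : (Fin t → ℝ × ℝ) × ((Fin K → ℝ) × ℝ) => pol t p.1 p.2.2 :=
    (hpol t).comp (measurable_fst.prodMk (measurable_snd.comp measurable_snd))
  have h2 : Measurable fun p : (Fin t → ℝ × ℝ) × ((Fin K → ℝ) × ℝ) => p.2.1 (pol t p.1 p.2.2) :=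
    measurable_eval2.comp ((measurable_fst.comp measurable_snd).prodMk h1)
  exact (measurable_snoc' t).comp
    (measurable_fst.prodMk (h2.prodMk (measurable_snd.comp measurable_snd)))

lemma lawQ_prob {pol : (t : ℕ) → (Fin t → ℝ × ℝ) → ℝ → Fin K}
    (hpol : ∀ t, Measurable fun p : (Fin t → ℝ × ℝ) × ℝ => pol t p.1 p.2)
    (μ : Fin K → Measure ℝ) (PG : Measure ℝ) [∀ i, IsProbabilityMeasure (μ i)]
    [IsProbabilityMeasure PG] (t : ℕ) : IsProbabilityMeasure (lawQ pol μ PG t) := by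
  induction t with
  | zero => unfold lawQ; infer_instance
  | succ t ih =>
    unfold lawQ
    exact Measure.isProbabilityMeasure_map (measurable_stepMap hpol t).aemeasurable

lemma hist_congr (pol : (t : ℕ) → (Fin t → ℝ × ℝ) → ℝ → Fin K)
    {Y Y' : ℕ → Fin K → ℝ} {G G' : ℕ → ℝ} (t : ℕ) (hY : ∀ s < t, Y s = Y' s)
    (hG : ∀ s < t, G s = G' s) : hist pol Y G t = hist pol Y' G' t := by
  induction t with
  | zero => rfl
  | succ t ih =>
    have := ih (fun s hs => hY s (by omega)) (fun s hs => hG s (by omega))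
    simp only [hist, this, hY t (by omega), hG t (by omega)]

lemma Yext_snoc {t : ℕ} (y : Fin t → Fin K → ℝ) (x : Fin K → ℝ) :
    (∀ s < t, Yext (Fin.snoc y x : Fin (t + 1) → Fin K → ℝ) s = Yext y s) ∧
      Yext (Fin.snoc y x : Fin (t + 1) → Fin K → ℝ) t = x := by
  constructor
  · intro s hs
    have : (⟨s, by omega⟩ : Fin (t + 1)) = Fin.castSucc ⟨s, hs⟩ := rfl
    simp only [Yext, hs, show s < t + 1 by omega, dif_pos, this, Fin.snoc_castSucc]
  · have : (⟨t, by omega⟩ : Fin (t + 1)) = Fin.last t := rfl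
    simp only [Yext, show t < t + 1 by omega, dif_pos, this, Fin.snoc_last]

lemma Gext_snoc {t : ℕ} (y : Fin t → ℝ) (x : ℝ) :
    (∀ s < t, Gext (Fin.snoc y x : Fin (t + 1) → ℝ) s = Gext y s) ∧
      Gext (Fin.snoc y x : Fin (t + 1) → ℝ) t = x := by
  constructor
  · intro s hs
    have : (⟨s, by omega⟩ : Fin (t + 1)) = Fin.castSucc ⟨s, hs⟩ := rfl
    simp only [Gext, hs, show s < t + 1 by omega, dif_pos, this, Fin.snoc_castSucc]
  · have : (⟨t, by omega⟩ : Fin (t + 1)) = Fin.last t := rfl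
    simp only [Gext, show t < t + 1 by omega, dif_pos, this, Fin.snoc_last]

lemma mp_hist {pol : (t : ℕ) → (Fin t → ℝ × ℝ) → ℝ → Fin K}
    (hpol : ∀ t, Measurable fun p : (Fin t → ℝ × ℝ) × ℝ => pol t p.1 p.2)
    (μ : Fin K → Measure ℝ) (PG : Measure ℝ) [∀ i, IsProbabilityMeasure (μ i)]
    [IsProbabilityMeasure PG] (t : ℕ) :
    MeasurePreserving (fun ω : (Fin t → Fin K → ℝ) × (Fin t → ℝ) =>
        hist pol (Yext ω.1) (Gext ω.2) t)
      ((Measure.pi fun _ => Measure.pi μ).prod (Measure.pi fun _ => PG)) (lawQ pol μ PG t) := by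
  induction t with
  | zero =>
    refine ⟨measurable_const, ?_⟩
    simp only [hist, lawQ]
    rw [Measure.map_const]; simp
  | succ t ih =>
    have := lawQ_prob hpol μ PG t
    have e1 := (ih.prod (MeasurePreserving.id ((Measure.pi μ).prod PG)))
    have e2 : MeasurePreserving (stepMap pol t) ((lawQ pol μ PG t).prod ((Measure.pi μ).prod PG))
      (lawQ pol μ PG (t + 1)) := ⟨measurable_stepMap hpol t, rfl⟩
    have e3 := e2.comp e1
    have f1 := (measurePreserving_piFinSuccAbove (fun _ : Fin (t + 1) => Measure.pi μ) (Fin.last t))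
    have f2 := (measurePreserving_piFinSuccAbove (fun _ : Fin (t + 1) => PG) (Fin.last t))
    have f3 := (Measure.measurePreserving_swap.comp f1).prod (Measure.measurePreserving_swap.comp f2)
    have f4 := (mp_rearr _ _ _ _).comp f3
    have f5 := e3.comp f4
    convert f5 using 1
    funext ω
    obtain ⟨y, g⟩ := ω
    obtain ⟨y, x, rfl⟩ : ∃ y' x, y = Fin.snoc y' x := ⟨Fin.init y, y (Fin.last t), by simp⟩
    obtain ⟨g, z, rfl⟩ : ∃ y' x, g = Fin.snoc y' x := ⟨Fin.init g, g (Fin.last t), by simp⟩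
    have hh := hist_congr pol t (Yext_snoc y x).1 (Gext_snoc g z).1
    simp only [hist, (Yext_snoc y x).2, (Gext_snoc g z).2, hh]
    simp [stepMap, MeasurableEquiv.piFinSuccAbove, Fin.insertNthEquiv,
      Function.comp_def]

lemma mp_final {n : ℕ} {pol : (t : ℕ) → (Fin t → ℝ × ℝ) → ℝ → Fin K}
    (hpol : ∀ t, Measurable fun p : (Fin t → ℝ × ℝ) × ℝ => pol t p.1 p.2)
    (μ : Fin K → Measure ℝ) (PG : Measure ℝ) [∀ i, IsProbabilityMeasure (μ i)]
    [IsProbabilityMeasure PG] :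
    MeasurePreserving (fun ω : (Fin n → Fin K → ℝ) × (Fin (n + 1) → ℝ) =>
        (hist pol (Yext ω.1) (Gext ω.2) n, ω.2 (Fin.last n)))
      ((Measure.pi fun _ => Measure.pi μ).prod (Measure.pi fun _ => PG))
      ((lawQ pol μ PG n).prod PG) := by
  have := lawQ_prob hpol μ PG n
  have f2 := (measurePreserving_piFinSuccAbove (fun _ : Fin (n + 1) => PG) (Fin.last n))
  have f3 := (MeasurePreserving.id (Measure.pi fun _ : Fin n => Measure.pi μ)).prod
    (Measure.measurePreserving_swap.comp f2)
  have f4 := ((measurePreserving_prodAssoc (Measure.pi fun _ : Fin n => Measure.pi μ)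
    (Measure.pi fun _ : Fin n => PG) PG).symm).comp f3
  have f5 := ((mp_hist hpol μ PG n).prod (MeasurePreserving.id PG)).comp f4
  convert f5 using 1
  funext ω
  obtain ⟨y, g⟩ := ω
  obtain ⟨g, z, rfl⟩ : ∃ y' x, g = Fin.snoc y' x := ⟨Fin.init g, g (Fin.last n), by simp⟩
  have hh := hist_congr pol n (Y := Yext y) (fun _ _ => rfl) (Gext_snoc g z).1
  simp only [hh]
  simp [MeasurableEquiv.piFinSuccAbove, Fin.insertNthEquiv,
      Function.comp_def, MeasurableEquiv.prodAssoc]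

def lik (pol : (t : ℕ) → (Fin t → ℝ × ℝ) → ℝ → Fin K) (i : Fin K) (r : ℝ → ℝ) :
    (t : ℕ) → (Fin t → ℝ × ℝ) → ℝ
  | 0, _ => 1
  | t + 1, h => lik pol i r t (Fin.init h) *
      (if pol t (Fin.init h) (h (Fin.last t)).2 = i then r (h (Fin.last t)).1 else 1)

lemma lik_step (pol : (t : ℕ) → (Fin t → ℝ × ℝ) → ℝ → Fin K) (i : Fin K) (r : ℝ → ℝ) (t : ℕ)
    (h : Fin t → ℝ × ℝ) (y : Fin K → ℝ) (g : ℝ) :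
    lik pol i r (t + 1) (stepMap pol t (h, (y, g))) =
      lik pol i r t h * (if pol t h g = i then r (y i) else 1) := by
  simp only [lik, stepMap, Fin.init_snoc, Fin.snoc_last]
  by_cases hi : pol t h g = i
  · simp [hi]
  · simp [hi]

lemma measurable_lik {pol : (t : ℕ) → (Fin t → ℝ × ℝ) → ℝ → Fin K}
    (hpol : ∀ t, Measurable fun p : (Fin t → ℝ × ℝ) × ℝ => pol t p.1 p.2)
    (i : Fin K) {r : ℝ → ℝ} (hr : Measurable r) (t : ℕ) : Measurable (lik pol i r t) := by
  induction t with
  | zero => exact measurable_const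
  | succ t ih =>
    have hinit : Measurable (fun h : Fin (t + 1) → ℝ × ℝ => (Fin.init h : Fin t → ℝ × ℝ)) :=
      measurable_pi_iff.2 fun j => measurable_pi_apply _
    have hl : Measurable (fun h : Fin (t + 1) → ℝ × ℝ => h (Fin.last t)) := measurable_pi_apply _
    have hp : Measurable (fun h : Fin (t + 1) → ℝ × ℝ =>
        pol t (Fin.init h) (h (Fin.last t)).2) :=
      (hpol t).comp (hinit.prodMk (measurable_snd.comp hl))
    refine (ih.comp hinit).mul (Measurable.ite ?_ (hr.comp (measurable_fst.comp hl))
      measurable_const)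
    exact hp (measurableSet_singleton i)

lemma lik_bound (pol : (t : ℕ) → (Fin t → ℝ × ℝ) → ℝ → Fin K) (i : Fin K) {r : ℝ → ℝ}
    (hr1 : ∀ x, 1 / 2 ≤ r x) (hr2 : ∀ x, r x ≤ 2) (t : ℕ) (h : Fin t → ℝ × ℝ) :
    (1 / 2 : ℝ) ^ t ≤ lik pol i r t h ∧ lik pol i r t h ≤ 2 ^ t := by
  induction t with
  | zero => simp [lik]
  | succ t ih =>
    have h0 := ih (Fin.init h)
    have hpos : (0 : ℝ) < (1 / 2) ^ t := by positivity
    unfold lik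
    rw [pow_succ, pow_succ]
    have hx : (1 / 2 : ℝ) ≤ (if pol t (Fin.init h) (h (Fin.last t)).2 = i
        then r (h (Fin.last t)).1 else 1) ∧ (if pol t (Fin.init h) (h (Fin.last t)).2 = i
        then r (h (Fin.last t)).1 else 1) ≤ 2 := by
      split_ifs
      · exact ⟨hr1 _, hr2 _⟩
      · norm_num
    constructor
    · exact mul_le_mul h0.1 hx.1 (by norm_num) (by linarith)
    · exact mul_le_mul h0.2 hx.2 (by linarith) (by positivity)

lemma lik_pos (pol : (t : ℕ) → (Fin t → ℝ × ℝ) → ℝ → Fin K) (i : Fin K) {r : ℝ → ℝ}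
    (hr1 : ∀ x, 1 / 2 ≤ r x) (hr2 : ∀ x, r x ≤ 2) (t : ℕ) (h : Fin t → ℝ × ℝ) :
    0 < lik pol i r t h :=
  lt_of_lt_of_le (by positivity) (lik_bound pol i hr1 hr2 t h).1

lemma lawQ_density {pol : (t : ℕ) → (Fin t → ℝ × ℝ) → ℝ → Fin K}
    (hpol : ∀ t, Measurable fun p : (Fin t → ℝ × ℝ) × ℝ => pol t p.1 p.2)
    (ν ν' : Fin K → Measure ℝ) (PG : Measure ℝ) [∀ i, IsProbabilityMeasure (ν i)]
    [∀ i, IsProbabilityMeasure (ν' i)]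
    [IsProbabilityMeasure PG] (i : Fin K) {r : ℝ → ℝ} (hr : Measurable r)
    (hr1 : ∀ x, 1 / 2 ≤ r x) (hr2 : ∀ x, r x ≤ 2)
    (hi : ν' i = (ν i).withDensity (fun x => ENNReal.ofReal (r x)))
    (hj : ∀ j, j ≠ i → ν' j = ν j) (t : ℕ) :
    lawQ pol ν' PG t = (lawQ pol ν PG t).withDensity
      (fun h => ENNReal.ofReal (lik pol i r t h)) := by
  induction t with
  | zero => simp [lawQ, lik]
  | succ t ih =>
    have := lawQ_prob hpol ν PG t
    have := lawQ_prob hpol ν' PG t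
    have hstep := measurable_stepMap hpol t
    have hL := (measurable_lik hpol i hr t).ennreal_ofReal
    have hL1 := (measurable_lik hpol i hr (t + 1)).ennreal_ofReal
    refine Measure.ext_of_lintegral _ fun f hf => ?_
    rw [lintegral_withDensity_eq_lintegral_mul _ hL1 hf]
    simp only [lawQ]
    have hfs : Measurable fun a => f (stepMap pol t a) := hf.comp hstep
    have hLs : Measurable fun a =>
        ((fun x => ENNReal.ofReal (lik pol i r (t + 1) x)) * f) (stepMap pol t a) :=
      (hL1.mul hf).comp hstep
    rw [lintegral_map hf hstep, lintegral_map (hL1.mul hf) hstep,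
      lintegral_prod _ hfs.aemeasurable,
      lintegral_prod _ hLs.aemeasurable, ih,
      lintegral_withDensity_eq_lintegral_mul _ hL hfs.lintegral_prod_right']
    refine lintegral_congr fun h => ?_
    simp only [Pi.mul_apply]
    have hsh : Measurable fun q : (Fin K → ℝ) × ℝ => stepMap pol t (h, q) :=
      hstep.comp (measurable_const.prodMk measurable_id)
    have hfh : Measurable fun q : (Fin K → ℝ) × ℝ => f (stepMap pol t (h, q)) := hf.comp hsh
    have hLfh : Measurable fun q : (Fin K → ℝ) × ℝ =>
        ENNReal.ofReal (lik pol i r (t + 1) (stepMap pol t (h, q))) * f (stepMap pol t (h, q)) :=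
      (hL1.mul hf).comp hsh
    rw [lintegral_prod_symm _ hfh.aemeasurable, lintegral_prod_symm _ hLfh.aemeasurable,
      ← lintegral_const_mul _ hfh.lintegral_prod_left']
    refine lintegral_congr fun g => ?_
    simp only [lik_step]
    have hψ : Measurable fun y : ℝ => f (Fin.snoc h (y, g)) := by
      exact hf.comp ((measurable_snoc' t).comp
        (measurable_const.prodMk (measurable_id.prodMk measurable_const)))
    have hrψ : Measurable fun y : ℝ => (if pol t h g = i then ENNReal.ofReal (r y) else 1) *
        f (Fin.snoc h (y, g)) := by
      refine Measurable.mul ?_ hψ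
      split_ifs
      · exact hr.ennreal_ofReal
      · exact measurable_const
    have key (m : Fin K → Measure ℝ) [∀ i, IsProbabilityMeasure (m i)] (φ : ℝ → ENNReal)
        (hφ : Measurable φ) (a : Fin K) : ∫⁻ y, φ (y a) ∂(Measure.pi m) = ∫⁻ y, φ y ∂(m a) :=
      (measurePreserving_eval m a).lintegral_comp hφ
    have hnn : 0 ≤ lik pol i r t h := (lik_pos pol i hr1 hr2 t h).le
    have e1 : ∫⁻ y, f (stepMap pol t (h, (y, g))) ∂(Measure.pi ν') =
        ∫⁻ y, f (Fin.snoc h (y, g)) ∂(ν' (pol t h g)) :=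
      key ν' (fun y => f (Fin.snoc h (y, g))) hψ (pol t h g)
    have e2 : ∫⁻ y, ENNReal.ofReal (lik pol i r t h * (if pol t h g = i then r (y i) else 1)) *
          f (stepMap pol t (h, (y, g))) ∂(Measure.pi ν) =
        ENNReal.ofReal (lik pol i r t h) * ∫⁻ y, (if pol t h g = i then ENNReal.ofReal (r y) else 1) *
        f (Fin.snoc h (y, g)) ∂(ν (pol t h g)) := by
      rw [← key ν _ hrψ (pol t h g), ← lintegral_const_mul' _ _ ENNReal.ofReal_ne_top]
      refine lintegral_congr fun y => ?_
      rw [ENNReal.ofReal_mul hnn, mul_assoc]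
      congr 2
      split_ifs with hh
      · rw [hh]
      · simp
    rw [e1, e2]
    congr 1
    by_cases hh : pol t h g = i
    · rw [hh, hi, lintegral_withDensity_eq_lintegral_mul _ hr.ennreal_ofReal hψ]
      simp
    · rw [hj _ hh]; simp [hh]

lemma abs_log_bound {x B : ℝ} (hB : 0 < B) (h1 : 1 / B ≤ x) (h2 : x ≤ B) :
    ‖Real.log x‖ ≤ Real.log B := by
  have hx : 0 < x := lt_of_lt_of_le (by positivity) h1
  rw [Real.norm_eq_abs, abs_le]
  constructor
  · rw [← Real.log_inv, ← one_div]
    exact Real.log_le_log (by positivity) h1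
  · exact Real.log_le_log hx h2

lemma integrable_log_lik {pol : (t : ℕ) → (Fin t → ℝ × ℝ) → ℝ → Fin K}
    (hpol : ∀ t, Measurable fun p : (Fin t → ℝ × ℝ) × ℝ => pol t p.1 p.2)
    (i : Fin K) {r : ℝ → ℝ} (hr : Measurable r)
    (hr1 : ∀ x, 1 / 2 ≤ r x) (hr2 : ∀ x, r x ≤ 2) (t : ℕ) (P : Measure (Fin t → ℝ × ℝ))
    [IsProbabilityMeasure P] : Integrable (fun h => Real.log (lik pol i r t h)) P := by
  refine Integrable.of_bound (measurable_lik hpol i hr t).log.aestronglyMeasurable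
    (Real.log (2 ^ t)) (Filter.Eventually.of_forall fun h => ?_)
  have := lik_bound pol i hr1 hr2 t h
  exact abs_log_bound (by positivity) (by simpa using this.1) this.2

lemma sum_log_lik {pol : (t : ℕ) → (Fin t → ℝ × ℝ) → ℝ → Fin K}
    (hpol : ∀ t, Measurable fun p : (Fin t → ℝ × ℝ) × ℝ => pol t p.1 p.2)
    (ν : Fin K → Measure ℝ) (PG : Measure ℝ) [∀ i, IsProbabilityMeasure (ν i)]
    [IsProbabilityMeasure PG] {r : Fin K → ℝ → ℝ} (hr : ∀ i, Measurable (r i))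
    (hr1 : ∀ i x, 1 / 2 ≤ r i x) (hr2 : ∀ i x, r i x ≤ 2) (η : ℝ)
    (hη : ∀ i, -η ≤ ∫ x, Real.log (r i x) ∂(ν i)) (t : ℕ) :
    -(t * η) ≤ ∫ h, ∑ i, Real.log (lik pol i (r i) t h) ∂(lawQ pol ν PG t) := by
  induction t with
  | zero => simp [lik]
  | succ t ih =>
    have hQ := lawQ_prob hpol ν PG t
    have hQ1 := lawQ_prob hpol ν PG (t + 1)
    have hstep := measurable_stepMap hpol t
    have hS (t) : Measurable fun h => ∑ i, Real.log (lik pol i (r i) t h) :=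
      Finset.measurable_sum _ fun i _ => (measurable_lik hpol i (hr i) t).log
    have hpm : Measurable fun p : (Fin t → ℝ × ℝ) × ((Fin K → ℝ) × ℝ) => pol t p.1 p.2.2 :=
      (hpol t).comp (measurable_fst.prodMk (measurable_snd.comp measurable_snd))
    have hpm2 : Measurable fun p : (Fin t → ℝ × ℝ) × ((Fin K → ℝ) × ℝ) =>
        p.2.1 (pol t p.1 p.2.2) :=
      measurable_eval2.comp ((measurable_fst.comp measurable_snd).prodMk hpm)
    have hlr : Measurable fun q : ℝ × Fin K => Real.log (r q.2 q.1) :=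
      measurable_from_prod_countable_left fun i => (hr i).log
    have hm : Measurable fun p : (Fin t → ℝ × ℝ) × ((Fin K → ℝ) × ℝ) =>
        Real.log (r (pol t p.1 p.2.2) (p.2.1 (pol t p.1 p.2.2))) := hlr.comp (hpm2.prodMk hpm)
    have hb : ∀ i x, ‖Real.log (r i x)‖ ≤ Real.log 2 := fun i x =>
      abs_log_bound (by norm_num) (hr1 i x) (hr2 i x)
    have hint : Integrable (fun p : (Fin t → ℝ × ℝ) × ((Fin K → ℝ) × ℝ) =>
        Real.log (r (pol t p.1 p.2.2) (p.2.1 (pol t p.1 p.2.2))))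
        ((lawQ pol ν PG t).prod ((Measure.pi ν).prod PG)) :=
      Integrable.of_bound hm.aestronglyMeasurable _ (Filter.Eventually.of_forall fun p => hb _ _)
    have hint2 : Integrable (fun h => ∑ i, Real.log (lik pol i (r i) t h)) (lawQ pol ν PG t) :=
      integrable_finsetSum _ fun i _ => integrable_log_lik hpol i (hr i) (hr1 i) (hr2 i) t _
    have e1 : ∫ h, ∑ i, Real.log (lik pol i (r i) (t + 1) h) ∂(lawQ pol ν PG (t + 1)) =
        ∫ p : (Fin t → ℝ × ℝ) × ((Fin K → ℝ) × ℝ),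
          ((∑ i, Real.log (lik pol i (r i) t p.1)) +
            Real.log (r (pol t p.1 p.2.2) (p.2.1 (pol t p.1 p.2.2))))
          ∂((lawQ pol ν PG t).prod ((Measure.pi ν).prod PG)) := by
      simp only [lawQ]
      rw [integral_map hstep.aemeasurable (hS (t + 1)).aestronglyMeasurable]
      refine integral_congr_ae (Filter.Eventually.of_forall fun p => ?_)
      obtain ⟨h, y, g⟩ := p
      simp only [lik_step]
      have : ∀ i, Real.log (lik pol i (r i) t h * (if pol t h g = i then r i (y i) else 1)) =
          Real.log (lik pol i (r i) t h) + (if pol t h g = i then Real.log (r i (y i)) else 0) := by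
        intro i
        have hp := lik_pos pol i (hr1 i) (hr2 i) t h
        split_ifs
        · rw [Real.log_mul hp.ne' (by have := hr1 i (y i); positivity)]
        · simp
      simp only [this, Finset.sum_add_distrib]
      simp
    have e2 : -η ≤ ∫ p : (Fin t → ℝ × ℝ) × ((Fin K → ℝ) × ℝ),
            Real.log (r (pol t p.1 p.2.2) (p.2.1 (pol t p.1 p.2.2)))
          ∂((lawQ pol ν PG t).prod ((Measure.pi ν).prod PG)) := by
      rw [integral_prod _ hint]
      have hin : ∀ h : Fin t → ℝ × ℝ, Integrable (fun q : (Fin K → ℝ) × ℝ =>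
          Real.log (r (pol t h q.2) (q.1 (pol t h q.2)))) ((Measure.pi ν).prod PG) := fun h =>
        Integrable.of_bound (hm.comp (measurable_const.prodMk measurable_id)).aestronglyMeasurable
          _ (Filter.Eventually.of_forall fun p => hb _ _)
      have hh : ∀ h : Fin t → ℝ × ℝ, -η ≤ ∫ q : (Fin K → ℝ) × ℝ,
          Real.log (r (pol t h q.2) (q.1 (pol t h q.2))) ∂((Measure.pi ν).prod PG) := by
        intro h
        rw [integral_prod_symm _ (hin h)]
        have : ∀ g : ℝ, -η ≤ ∫ y : Fin K → ℝ, Real.log (r (pol t h g) (y (pol t h g)))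
            ∂(Measure.pi ν) := by
          intro g
          have e := integral_map (μ := Measure.pi ν)
            (measurable_pi_apply (pol t h g)).aemeasurable
            (f := fun y => Real.log (r (pol t h g) y)) (hr _).log.aestronglyMeasurable
          rw [(measurePreserving_eval ν (pol t h g)).map_eq] at e
          rw [← e]
          exact hη _
        calc -η = ∫ g, -η ∂PG := by simp
          _ ≤ _ := integral_mono (integrable_const _) (hin h).integral_prod_right this
      calc -η = ∫ g, -η ∂(lawQ pol ν PG t) := by simp
          _ ≤ _ := integral_mono (integrable_const _) hint.integral_prod_left hh
    rw [e1, integral_add (hint2.comp_fst _) hint]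
    have e3 : ∫ p : (Fin t → ℝ × ℝ) × ((Fin K → ℝ) × ℝ), (∑ i, Real.log (lik pol i (r i) t p.1))
          ∂((lawQ pol ν PG t).prod ((Measure.pi ν).prod PG)) =
        ∫ h, ∑ i, Real.log (lik pol i (r i) t h) ∂(lawQ pol ν PG t) := by
      rw [integral_fun_fst (fun h => ∑ i, Real.log (lik pol i (r i) t h))]
      simp
    rw [e3]
    push_cast
    linarith

lemma pointwise_ineq {L : ℝ} (hL : 0 < L) {φ : ℝ} (h0 : 0 ≤ φ) (h1 : φ ≤ 1) :
    1 + Real.log L / 2 - (1 + L) / 4 ≤ φ + (1 - φ) * L := by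
  obtain ⟨s, hs, rfl⟩ : ∃ s : ℝ, 0 < s ∧ L = s ^ 2 :=
    ⟨Real.sqrt L, Real.sqrt_pos.2 hL, (Real.sq_sqrt hL.le).symm⟩
  have h2 : Real.log (s ^ 2) / 2 ≤ s - 1 := by
    rw [Real.log_pow]; have := Real.log_le_sub_one_of_pos hs; push_cast; linarith
  have : s - (1 + s ^ 2) / 4 ≤ φ + (1 - φ) * s ^ 2 := by
    rcases le_total s 1 with h | h
    · have : s ^ 2 ≤ 1 := by nlinarith
      nlinarith [mul_nonneg h0 (sub_nonneg.2 this), sq_nonneg (s - 2/5), sq_nonneg (5 * s - 2)]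
    · have : 1 ≤ s ^ 2 := by nlinarith
      nlinarith [mul_nonneg (sub_nonneg.2 h1) (sub_nonneg.2 this), sq_nonneg (s - 2)]
  linarith

lemma two_point {n : ℕ} {pol : (t : ℕ) → (Fin t → ℝ × ℝ) → ℝ → Fin K}
    (hpol : ∀ t, Measurable fun p : (Fin t → ℝ × ℝ) × ℝ => pol t p.1 p.2)
    (ν : Fin K → Measure ℝ) (ν' : Fin K → Fin K → Measure ℝ)
    (PG : Measure ℝ) [∀ i, IsProbabilityMeasure (ν i)]
    [∀ i j, IsProbabilityMeasure (ν' i j)]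
    [IsProbabilityMeasure PG] {r : Fin K → ℝ → ℝ} (hr : ∀ i, Measurable (r i))
    (hr1 : ∀ i x, 1 / 2 ≤ r i x) (hr2 : ∀ i x, r i x ≤ 2)
    (hi : ∀ i, ν' i i = (ν i).withDensity (fun x => ENNReal.ofReal (r i x)))
    (hj : ∀ i j, j ≠ i → ν' i j = ν j) (η : ℝ)
    (hη : ∀ i, -η ≤ ∫ x, Real.log (r i x) ∂(ν i))
    (φ : (Fin n → ℝ × ℝ) → ℝ) (hφ : Measurable φ) (h0 : ∀ h, 0 ≤ φ h) (h1 : ∀ h, φ h ≤ 1) :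
    K / 2 - n * η / 2 ≤ K * ∫ h, φ h ∂(lawQ pol ν PG n) +
      ∑ i, ∫ h, (1 - φ h) ∂(lawQ pol (ν' i) PG n) := by
  have hQ := lawQ_prob hpol ν PG n
  have hφb : Integrable φ (lawQ pol ν PG n) := Integrable.of_bound hφ.aestronglyMeasurable 1
    (Filter.Eventually.of_forall fun h => by
      rw [Real.norm_eq_abs, abs_le]; constructor <;> linarith [h0 h, h1 h])
  have hLint : ∀ i, Integrable (lik pol i (r i) n) (lawQ pol ν PG n) := fun i =>
    Integrable.of_bound (measurable_lik hpol i (hr i) n).aestronglyMeasurable (2 ^ n)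
    (Filter.Eventually.of_forall fun h => by
      have := lik_bound pol i (hr1 i) (hr2 i) n h
      have := lik_pos pol i (hr1 i) (hr2 i) n h
      rw [Real.norm_eq_abs, abs_le]; constructor <;> linarith)
  have hlog := fun i => integrable_log_lik hpol i (hr i) (hr1 i) (hr2 i) n (lawQ pol ν PG n)
  have wd : ∀ i, ∀ f : (Fin n → ℝ × ℝ) → ℝ,
      ∫ h, f h ∂(lawQ pol (ν' i) PG n) = ∫ h, f h * lik pol i (r i) n h ∂(lawQ pol ν PG n) := by
    intro i f
    rw [lawQ_density hpol ν (ν' i) PG i (hr i) (hr1 i) (hr2 i) (hi i) (hj i) n,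
      integral_withDensity_eq_integral_toReal_smul
        (measurable_lik hpol i (hr i) n).ennreal_ofReal
        (Filter.Eventually.of_forall fun _ => ENNReal.ofReal_lt_top)]
    refine integral_congr_ae (Filter.Eventually.of_forall fun h => ?_)
    simp only [ENNReal.toReal_ofReal (lik_pos pol i (hr1 i) (hr2 i) n h).le, smul_eq_mul]
    ring
  have hL1 : ∀ i, ∫ h, lik pol i (r i) n h ∂(lawQ pol ν PG n) = 1 := by
    intro i
    have := wd i (fun _ => 1)
    have hp := lawQ_prob hpol (ν' i) PG n
    simp only [integral_const, probReal_univ, one_mul, smul_eq_mul] at this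
    exact this.symm
  have hmulint : ∀ i, Integrable (fun h => (1 - φ h) * lik pol i (r i) n h) (lawQ pol ν PG n) := by
    intro i
    refine Integrable.bdd_mul (c := 1) (hLint i) (measurable_const.sub hφ).aestronglyMeasurable
      (Filter.Eventually.of_forall fun h => ?_)
    rw [Real.norm_eq_abs, abs_le]; constructor <;> linarith [h0 h, h1 h]
  have step : ∀ i, 1 / 2 + (∫ h, Real.log (lik pol i (r i) n h) ∂(lawQ pol ν PG n)) / 2 ≤
      ∫ h, φ h ∂(lawQ pol ν PG n) + ∫ h, (1 - φ h) ∂(lawQ pol (ν' i) PG n) := by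
    intro i
    rw [wd i, ← integral_add hφb (hmulint i)]
    have hA : Integrable (fun h => 1 + Real.log (lik pol i (r i) n h) / 2)
        (lawQ pol ν PG n) := (integrable_const _).add ((hlog i).div_const 2)
    have hB : Integrable (fun h => (1 + lik pol i (r i) n h) / 4) (lawQ pol ν PG n) :=
      ((integrable_const _).add (hLint i)).div_const 4
    have := integral_mono (hA.sub hB) (hφb.add (hmulint i)) fun h =>
      pointwise_ineq (lik_pos pol i (hr1 i) (hr2 i) n h) (h0 h) (h1 h)
    simp only [Pi.sub_apply, Pi.add_apply] at this
    rw [integral_sub hA hB, integral_add (integrable_const _) ((hlog i).div_const 2),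
      integral_div, integral_div, integral_add (integrable_const _) (hLint i), hL1 i] at this
    simp only [integral_const, probReal_univ, smul_eq_mul] at this
    linarith
  have hs := sum_log_lik hpol ν PG hr hr1 hr2 η hη n
  rw [integral_finsetSum _ fun i _ => hlog i] at hs
  have := Finset.sum_le_sum fun i (_ : i ∈ Finset.univ) => step i
  simp only [Finset.sum_add_distrib, Finset.sum_const, Finset.card_univ, Fintype.card_fin,
    nsmul_eq_mul, ← Finset.sum_div] at this
  linarith

lemma cdf_bounds {a b : ℝ} {H : ℝ → ℝ} (h : IsCdfOn a b H) (x : ℝ) : 0 ≤ H x ∧ H x ≤ 1 := by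
  obtain ⟨hm, _, h0, h1⟩ := h
  constructor
  · have := h0 (min x (a - 1)) (lt_of_le_of_lt (min_le_right _ _) (by linarith))
    rw [← this]; exact hm (min_le_left _ _)
  · have := h1 (max x b) (le_max_right _ _)
    rw [← this]; exact hm (le_max_left _ _)

lemma exists_measure {a b : ℝ} {H : ℝ → ℝ} (h : IsCdfOn a b H) :
    ∃ ν : Measure ℝ, IsProbabilityMeasure ν ∧ ∀ y, ν (Iic y) = ENNReal.ofReal (H y) := by
  let f : StieltjesFunction ℝ := ⟨H, h.1, h.2.1⟩
  have hb : Filter.Tendsto f Filter.atBot (nhds 0) := by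
    refine tendsto_const_nhds.congr' ?_
    filter_upwards [Filter.eventually_lt_atBot a] with x hx
    exact (h.2.2.1 x hx).symm
  have ht : Filter.Tendsto f Filter.atTop (nhds 1) := by
    refine tendsto_const_nhds.congr' ?_
    filter_upwards [Filter.eventually_ge_atTop b] with x hx
    exact (h.2.2.2 x hx).symm
  refine ⟨f.measure, f.isProbabilityMeasure hb ht, fun y => ?_⟩
  rw [f.measure_Iic hb, sub_zero]

def mixM (ν1 ν2 : Measure ℝ) (τ : ℝ) : Measure ℝ :=
  ENNReal.ofReal τ • ν1 + ENNReal.ofReal (1 - τ) • ν2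

lemma mixM_prob (ν1 ν2 : Measure ℝ) [IsProbabilityMeasure ν1] [IsProbabilityMeasure ν2] {τ : ℝ}
    (h : τ ∈ Icc (0 : ℝ) 1) : IsProbabilityMeasure (mixM ν1 ν2 τ) := by
  constructor
  simp only [mixM, Measure.add_apply, Measure.smul_apply, measure_univ, smul_eq_mul, mul_one]
  rw [← ENNReal.ofReal_add h.1 (by linarith [h.2])]
  simp

lemma mixM_Iic {ν1 ν2 : Measure ℝ} {H1 H2 : ℝ → ℝ} {a b : ℝ} (hc1 : IsCdfOn a b H1)
    (hc2 : IsCdfOn a b H2) (h1 : ∀ y, ν1 (Iic y) = ENNReal.ofReal (H1 y))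
    (h2 : ∀ y, ν2 (Iic y) = ENNReal.ofReal (H2 y)) {τ : ℝ} (h : τ ∈ Icc (0 : ℝ) 1) (y : ℝ) :
    mixM ν1 ν2 τ (Iic y) = ENNReal.ofReal (τ * H1 y + (1 - τ) * H2 y) := by
  have b1 := cdf_bounds hc1 y
  have b2 := cdf_bounds hc2 y
  have hτ : 0 ≤ 1 - τ := by linarith [h.2]
  simp only [mixM, Measure.add_apply, Measure.smul_apply, smul_eq_mul, h1, h2]
  rw [ENNReal.ofReal_add (mul_nonneg h.1 b1.1) (mul_nonneg hτ b2.1),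
    ENNReal.ofReal_mul h.1, ENNReal.ofReal_mul hτ]

lemma exists_dens (ν1 ν2 : Measure ℝ) [IsProbabilityMeasure ν1] [IsProbabilityMeasure ν2] :
    ∃ (m : Measure ℝ) (g : ℝ → ℝ), Measurable g ∧ (∀ x, 0 ≤ g x) ∧ (∀ x, g x ≤ 1) ∧
      ν1 = m.withDensity (fun x => ENNReal.ofReal (g x)) ∧
      ν2 = m.withDensity (fun x => ENNReal.ofReal (1 - g x)) := by
  let m := ν1 + ν2
  let f := ν1.rnDeriv m
  have hle : ν1 ≤ m := Measure.le_add_right le_rfl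
  have hf1 : f ≤ᵐ[m] 1 := Measure.rnDeriv_le_one_of_le hle
  have hfm : Measurable f := Measure.measurable_rnDeriv _ _
  have hν1 : m.withDensity f = ν1 := Measure.withDensity_rnDeriv_eq _ _ hle.absolutelyContinuous
  let g : ℝ → ℝ := fun x => (min (f x) 1).toReal
  have hgm : Measurable g := (hfm.min measurable_const).ennreal_toReal
  have hg1 : ∀ x, g x ≤ 1 := fun x => by
    have : (min (f x) 1).toReal ≤ (1 : ENNReal).toReal :=
      ENNReal.toReal_mono ENNReal.one_ne_top (min_le_right _ _)
    simpa using this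
  have hν1' : ν1 = m.withDensity (fun x => ENNReal.ofReal (g x)) := by
    rw [← hν1]
    refine withDensity_congr_ae ?_
    filter_upwards [hf1] with x hx
    have hx' : f x ≤ 1 := hx
    simp only [g, min_eq_left hx']
    rw [ENNReal.ofReal_toReal (ne_top_of_le_ne_top ENNReal.one_ne_top hx')]
  refine ⟨m, g, hgm, fun x => ENNReal.toReal_nonneg, hg1, hν1', ?_⟩
  have hsum : ν1 + m.withDensity (fun x => ENNReal.ofReal (1 - g x)) = ν1 + ν2 := by
    calc ν1 + m.withDensity (fun x => ENNReal.ofReal (1 - g x))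
        = m.withDensity (fun x => ENNReal.ofReal (g x)) +
          m.withDensity (fun x => ENNReal.ofReal (1 - g x)) := by rw [← hν1']
      _ = m.withDensity 1 := by
        rw [← withDensity_add_left hgm.ennreal_ofReal]
        congr 1
        funext x
        simp only [Pi.add_apply, Pi.one_apply]
        rw [← ENNReal.ofReal_add ENNReal.toReal_nonneg (by linarith [hg1 x])]
        change ENNReal.ofReal (g x + (1 - g x)) = 1
        simp
      _ = ν1 + ν2 := withDensity_one
  ext s hs
  have := congrArg (fun μ : Measure ℝ => μ s) hsum
  simp only [Measure.add_apply] at this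
  exact ((ENNReal.add_right_inj (measure_ne_top ν1 s)).1 this).symm

lemma mixM_dens {m : Measure ℝ} {ν1 ν2 : Measure ℝ} {g : ℝ → ℝ} (hg : Measurable g)
    (hg0 : ∀ x, 0 ≤ g x) (hg1 : ∀ x, g x ≤ 1)
    (h1 : ν1 = m.withDensity (fun x => ENNReal.ofReal (g x)))
    (h2 : ν2 = m.withDensity (fun x => ENNReal.ofReal (1 - g x))) {τ : ℝ}
    (h : τ ∈ Icc (0 : ℝ) 1) :
    mixM ν1 ν2 τ = m.withDensity (fun x => ENNReal.ofReal (τ * g x + (1 - τ) * (1 - g x))) := by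
  have hτ : 0 ≤ 1 - τ := by linarith [h.2]
  have hg' : Measurable fun x => 1 - g x := measurable_const.sub hg
  rw [mixM, h1, h2, ← withDensity_smul _ hg.ennreal_ofReal, ← withDensity_smul _ hg'.ennreal_ofReal,
    ← withDensity_add_left (hg.ennreal_ofReal.const_smul _)]
  congr 1
  funext x
  simp only [Pi.add_apply, Pi.smul_apply, smul_eq_mul]
  rw [ENNReal.ofReal_add (mul_nonneg h.1 (hg0 x)) (mul_nonneg hτ (by linarith [hg1 x])),
    ENNReal.ofReal_mul h.1, ENNReal.ofReal_mul hτ]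

lemma mixM_ratio (ν1 ν2 : Measure ℝ) [IsProbabilityMeasure ν1] [IsProbabilityMeasure ν2]
    {τ τ' ε : ℝ} (hτ1 : 3 / 8 ≤ τ) (hτ2 : τ ≤ 5 / 8) (hd : |τ' - τ| ≤ ε) (hε : ε ≤ 1 / 8) :
    ∃ r : ℝ → ℝ, Measurable r ∧ (∀ x, 1 / 2 ≤ r x) ∧ (∀ x, r x ≤ 2) ∧
      mixM ν1 ν2 τ' = (mixM ν1 ν2 τ).withDensity (fun x => ENNReal.ofReal (r x)) ∧
      -(32 * ε ^ 2) ≤ ∫ x, Real.log (r x) ∂(mixM ν1 ν2 τ) := by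
  obtain ⟨m, g, hg, hg0, hg1, h1, h2⟩ := exists_dens ν1 ν2
  rw [abs_le] at hd
  have hτ : τ ∈ Icc (0 : ℝ) 1 := ⟨by linarith, by linarith⟩
  have hτ' : τ' ∈ Icc (0 : ℝ) 1 := ⟨by linarith, by linarith⟩
  have hp := mixM_prob ν1 ν2 hτ
  have hp' := mixM_prob ν1 ν2 hτ'
  let q : ℝ → ℝ → ℝ := fun s x => s * g x + (1 - s) * (1 - g x)
  have hqm : ∀ s, Measurable (q s) := fun s =>
    (hg.const_mul s).add ((measurable_const.sub hg).const_mul (1 - s))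
  have hq : ∀ x, 3 / 8 ≤ q τ x := fun x => by
    simp only [q]; nlinarith [hg0 x, hg1 x]
  have hqd1 : ∀ x, q τ' x - q τ x ≤ ε := fun x => by
    simp only [q]; nlinarith [hg0 x, hg1 x]
  have hqd2 : ∀ x, -ε ≤ q τ' x - q τ x := fun x => by
    simp only [q]; nlinarith [hg0 x, hg1 x]
  let r : ℝ → ℝ := fun x => q τ' x / q τ x
  have hrm : Measurable r := (hqm τ').div (hqm τ)
  have hε0 : 0 ≤ ε := by linarith
  have hra : ∀ x, -(4 * ε) ≤ r x - 1 := fun x => by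
    have hpos : 0 < q τ x := by linarith [hq x]
    have : r x - 1 = (q τ' x - q τ x) / q τ x := by simp only [r]; field_simp
    rw [this, le_div_iff₀ hpos]; nlinarith [hq x, hqd2 x]
  have hrb : ∀ x, r x - 1 ≤ 4 * ε := fun x => by
    have hpos : 0 < q τ x := by linarith [hq x]
    have : r x - 1 = (q τ' x - q τ x) / q τ x := by simp only [r]; field_simp
    rw [this, div_le_iff₀ hpos]; nlinarith [hq x, hqd1 x]
  have hr1 : ∀ x, 1 / 2 ≤ r x := fun x => by linarith [hra x]
  have hr2 : ∀ x, r x ≤ 2 := fun x => by linarith [hrb x]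
  have hdens : mixM ν1 ν2 τ' = (mixM ν1 ν2 τ).withDensity (fun x => ENNReal.ofReal (r x)) := by
    rw [mixM_dens hg hg0 hg1 h1 h2 hτ, mixM_dens hg hg0 hg1 h1 h2 hτ',
      ← withDensity_mul _ (hqm τ).ennreal_ofReal hrm.ennreal_ofReal]
    congr 1
    funext x
    have hpos : 0 < q τ x := by linarith [hq x]
    simp only [Pi.mul_apply]
    rw [← ENNReal.ofReal_mul hpos.le]
    congr 1
    change q τ' x = q τ x * (q τ' x / q τ x)
    field_simp
  refine ⟨r, hrm, hr1, hr2, hdens, ?_⟩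
  have hrint : Integrable r (mixM ν1 ν2 τ) := Integrable.of_bound hrm.aestronglyMeasurable 2
    (Filter.Eventually.of_forall fun x => by
      rw [Real.norm_eq_abs, abs_le]; constructor <;> linarith [hr1 x, hr2 x])
  have hr_one : ∫ x, r x ∂(mixM ν1 ν2 τ) = 1 := by
    rw [integral_eq_lintegral_of_nonneg_ae (Filter.Eventually.of_forall fun x => by
      have := hr1 x; simp only [Pi.zero_apply]; linarith) hrm.aestronglyMeasurable]
    have : ∫⁻ x, ENNReal.ofReal (r x) ∂(mixM ν1 ν2 τ) = mixM ν1 ν2 τ' univ := by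
      rw [hdens, withDensity_apply _ MeasurableSet.univ]; simp
    rw [this]; simp
  have hlint : Integrable (fun x => Real.log (r x)) (mixM ν1 ν2 τ) :=
    Integrable.of_bound hrm.log.aestronglyMeasurable (Real.log 2)
    (Filter.Eventually.of_forall fun x => abs_log_bound (by norm_num) (hr1 x) (hr2 x))
  have hpt : ∀ x, r x - (1 + 32 * ε ^ 2) ≤ Real.log (r x) := fun x => by
    have hpos : 0 < r x := by linarith [hr1 x]
    have hl := Real.one_sub_inv_le_log_of_pos hpos
    have : r x - (1 + 32 * ε ^ 2) ≤ 1 - (r x)⁻¹ := by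
      have hsq : (r x - 1) ^ 2 ≤ 16 * ε ^ 2 := by nlinarith [hra x, hrb x]
      have : (r x - 1) ^ 2 * (r x)⁻¹ ≤ 16 * ε ^ 2 * 2 := by
        refine mul_le_mul hsq ?_ (by positivity) (by positivity)
        rw [inv_le_comm₀ hpos (by norm_num)]; linarith [hr1 x]
      have e : (r x - 1) ^ 2 * (r x)⁻¹ = r x - 2 + (r x)⁻¹ := by field_simp; ring
      linarith
    linarith
  have := integral_mono (hrint.sub (integrable_const (1 + 32 * ε ^ 2))) hlint hpt
  simp only [Pi.sub_apply] at this
  rw [integral_sub hrint (integrable_const _), hr_one] at this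
  simp only [integral_const, probReal_univ, smul_eq_mul] at this
  linarith

lemma mix_eq {H1 H2 : ℝ → ℝ} {δ τ : Fin K → ℝ} (hδ : δ ∈ stdSimplex ℝ (Fin K)) :
    mix δ (fun i z => τ i * H1 z + (1 - τ i) * H2 z) =
      fun x => (∑ i, δ i * τ i) * H1 x + (1 - ∑ i, δ i * τ i) * H2 x := by
  funext x
  simp only [mix]
  have h1 := hδ.2
  calc ∑ i, δ i * (τ i * H1 x + (1 - τ i) * H2 x)
      = ∑ i, ((δ i * τ i) * (H1 x - H2 x) + δ i * H2 x) :=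
        Finset.sum_congr rfl fun i _ => by ring
    _ = _ := by
      rw [Finset.sum_add_distrib, ← Finset.sum_mul, ← Finset.sum_mul, h1]; ring

lemma P_mem {δ τ : Fin K → ℝ} (hδ : δ ∈ stdSimplex ℝ (Fin K)) (hτ : ∀ i, τ i ∈ Icc (0 : ℝ) 1) :
    (∑ i, δ i * τ i) ∈ Icc (0 : ℝ) 1 := by
  constructor
  · exact Finset.sum_nonneg fun i _ => mul_nonneg (hδ.1 i) (hτ i).1
  · rw [← hδ.2]
    exact Finset.sum_le_sum fun i _ => mul_le_of_le_one_right (hδ.1 i) (hτ i).2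

lemma reg_bounds {T : (ℝ → ℝ) → ℝ} {H1 H2 : ℝ → ℝ} {c : ℝ} (hc : 0 < c)
    (hgrow : ∀ τ₁ τ₂ : ℝ, 0 ≤ τ₁ → τ₁ ≤ τ₂ → τ₂ ≤ 1 →
      c * (τ₂ - τ₁)
        ≤ T (fun x => τ₂ * H1 x + (1 - τ₂) * H2 x)
          - T (fun x => τ₁ * H1 x + (1 - τ₁) * H2 x))
    {M : Set (Fin K → ℝ)} (hM : M ⊆ stdSimplex ℝ (Fin K)) {τ : Fin K → ℝ}
    (hτ : ∀ i, τ i ∈ Icc (0 : ℝ) 1) {δ : Fin K → ℝ} (hδ : δ ∈ M) :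
    let F : Fin K → ℝ → ℝ := fun i z => τ i * H1 z + (1 - τ i) * H2 z
    let R := sSup ((fun δ => T (mix δ F)) '' M) - T (mix δ F)
    0 ≤ R ∧ R ≤ T (fun x => 1 * H1 x + (1 - 1) * H2 x) - T (fun x => 0 * H1 x + (1 - 0) * H2 x) ∧
      ∀ δ' ∈ M, c * (∑ i, δ' i * τ i - ∑ i, δ i * τ i) ≤ R := by
  intro F R
  have hmono : ∀ s t : ℝ, 0 ≤ s → s ≤ t → t ≤ 1 → T (fun x => s * H1 x + (1 - s) * H2 x) ≤
      T (fun x => t * H1 x + (1 - t) * H2 x) := fun s t h0 h1 h2 => by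
    have := hgrow s t h0 h1 h2
    have : 0 ≤ c * (t - s) := mul_nonneg hc.le (by linarith)
    linarith
  have hub : ∀ δ ∈ M, T (mix δ F) ≤ T (fun x => 1 * H1 x + (1 - 1) * H2 x) := fun δ h => by
    rw [mix_eq (hM h)]
    have := P_mem (hM h) hτ
    exact hmono _ 1 this.1 this.2 le_rfl
  have hlb : T (fun x => 0 * H1 x + (1 - 0) * H2 x) ≤ T (mix δ F) := by
    rw [mix_eq (hM hδ)]
    have := P_mem (hM hδ) hτ
    exact hmono 0 _ le_rfl this.1 this.2
  have hbdd : BddAbove ((fun δ => T (mix δ F)) '' M) :=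
    ⟨_, by rintro _ ⟨δ, h, rfl⟩; exact hub δ h⟩
  have hle : ∀ δ' ∈ M, T (mix δ' F) ≤ sSup ((fun δ => T (mix δ F)) '' M) := fun δ' h =>
    le_csSup hbdd ⟨δ', h, rfl⟩
  have hsup : sSup ((fun δ => T (mix δ F)) '' M) ≤ T (fun x => 1 * H1 x + (1 - 1) * H2 x) :=
    csSup_le ⟨_, δ, hδ, rfl⟩ (by rintro _ ⟨δ, h, rfl⟩; exact hub δ h)
  have hR0 : 0 ≤ R := sub_nonneg.2 (hle δ hδ)
  refine ⟨hR0, by simp only [R]; linarith, fun δ' hδ' => ?_⟩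
  rcases le_total (∑ i, δ i * τ i) (∑ i, δ' i * τ i) with h | h
  · have h1 := hgrow _ _ (P_mem (hM hδ) hτ).1 h (P_mem (hM hδ') hτ).2
    have h2 := hle δ' hδ'
    simp only [R]
    rw [mix_eq (hM hδ')] at h2
    rw [mix_eq (hM hδ)]
    linarith
  · have : c * (∑ i, δ' i * τ i - ∑ i, δ i * τ i) ≤ 0 :=
      mul_nonpos_of_nonneg_of_nonpos hc.le (by linarith)
    linarith

lemma expRegret_bounds {T : (ℝ → ℝ) → ℝ} {H1 H2 : ℝ → ℝ} {c : ℝ} (hc : 0 < c)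
    (hgrow : ∀ τ₁ τ₂ : ℝ, 0 ≤ τ₁ → τ₁ ≤ τ₂ → τ₂ ≤ 1 →
      c * (τ₂ - τ₁)
        ≤ T (fun x => τ₂ * H1 x + (1 - τ₂) * H2 x)
          - T (fun x => τ₁ * H1 x + (1 - τ₁) * H2 x))
    {M : Set (Fin K → ℝ)} (hM : M ⊆ stdSimplex ℝ (Fin K)) {τ : Fin K → ℝ}
    (hτ : ∀ i, τ i ∈ Icc (0 : ℝ) 1) {n : ℕ}
    {pol : (t : ℕ) → (Fin t → ℝ × ℝ) → ℝ → Fin K}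
    (hpol : ∀ t, Measurable fun p : (Fin t → ℝ × ℝ) × ℝ => pol t p.1 p.2)
    {polrec : (Fin n → ℝ × ℝ) → ℝ → (Fin K → ℝ)}
    (hrec : Measurable (fun p : (Fin n → ℝ × ℝ) × ℝ => polrec p.1 p.2))
    (hrecM : ∀ h g, polrec h g ∈ M) (μ : Fin K → ProbabilityMeasure ℝ) (PG : ProbabilityMeasure ℝ) :
    let F : Fin K → ℝ → ℝ := fun i z => τ i * H1 z + (1 - τ i) * H2 z
    0 ≤ expectedRegret n T M pol polrec F μ PG ∧
    expectedRegret n T M pol polrec F μ PG ≤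
      T (fun x => 1 * H1 x + (1 - 1) * H2 x) - T (fun x => 0 * H1 x + (1 - 0) * H2 x) ∧
    ∀ (B : Set (Fin K → ℝ)) (e : ℝ), MeasurableSet B → 0 ≤ e →
      (∀ δ ∈ M, δ ∈ B → e ≤ sSup ((fun δ => T (mix δ F)) '' M) - T (mix δ F)) →
      e * ∫ h, (PG : Measure ℝ).real {g | polrec h g ∈ B} ∂(lawQ pol (fun i => (μ i : Measure ℝ)) PG n)
        ≤ expectedRegret n T M pol polrec F μ PG := by
  intro F
  have hQ := lawQ_prob hpol (fun i => (μ i : Measure ℝ)) PG n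
  let Q := lawQ pol (fun i => (μ i : Measure ℝ)) PG n
  let R : (Fin n → ℝ × ℝ) × ℝ → ℝ := fun p =>
    sSup ((fun δ => T (mix δ F)) '' M) - T (mix (polrec p.1 p.2) F)
  have hb := fun p : (Fin n → ℝ × ℝ) × ℝ => reg_bounds hc hgrow hM hτ (hrecM p.1 p.2)
  let Φ : ℝ → ℝ := fun s => T (fun x => (max 0 (min s 1)) * H1 x + (1 - max 0 (min s 1)) * H2 x)
  have hΦ : Monotone Φ := by
    intro s t hst
    have h1 : max 0 (min s 1) ≤ max 0 (min t 1) := max_le_max le_rfl (min_le_min hst le_rfl)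
    have := hgrow (max 0 (min s 1)) (max 0 (min t 1)) (le_max_left _ _) h1
      (max_le zero_le_one (min_le_right _ _))
    have : 0 ≤ c * (max 0 (min t 1) - max 0 (min s 1)) := mul_nonneg hc.le (by linarith)
    simp only [Φ]; linarith
  have hRm : Measurable R := by
    have : R = fun p => sSup ((fun δ => T (mix δ F)) '' M) - Φ (∑ i, polrec p.1 p.2 i * τ i) := by
      funext p
      have hp := P_mem (hM (hrecM p.1 p.2)) hτ
      simp only [R, Φ, F]
      rw [mix_eq (hM (hrecM p.1 p.2)), min_eq_left hp.2, max_eq_right hp.1]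
    rw [this]
    refine measurable_const.sub (hΦ.measurable.comp ?_)
    exact Finset.measurable_sum _ fun i _ => ((measurable_pi_apply i).comp hrec).mul_const _
  have hER : expectedRegret n T M pol polrec F μ PG = ∫ p, R p ∂(Q.prod (PG : Measure ℝ)) := by
    have hmp := mp_final (n := n) hpol (fun i => (μ i : Measure ℝ)) (PG : Measure ℝ)
    rw [← hmp.map_eq, integral_map hmp.measurable.aemeasurable hRm.aestronglyMeasurable]
    rfl
  have hRint : Integrable R (Q.prod (PG : Measure ℝ)) :=
    Integrable.of_bound hRm.aestronglyMeasurable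
      (T (fun x => 1 * H1 x + (1 - 1) * H2 x) - T (fun x => 0 * H1 x + (1 - 0) * H2 x))
      (Filter.Eventually.of_forall fun p => by
        rw [Real.norm_eq_abs, abs_of_nonneg (hb p).1]; exact (hb p).2.1)
  rw [hER]
  refine ⟨integral_nonneg fun p => (hb p).1, ?_, fun B e hB he hBe => ?_⟩
  · have := integral_mono hRint (integrable_const _) fun p => (hb p).2.1
    simpa using this
  · let S : Set ((Fin n → ℝ × ℝ) × ℝ) := {p | polrec p.1 p.2 ∈ B}
    have hS : MeasurableSet S := hrec hB
    have h1 : ∫ p, S.indicator (fun _ => e) p ∂(Q.prod (PG : Measure ℝ)) ≤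
        ∫ p, R p ∂(Q.prod (PG : Measure ℝ)) := by
      refine integral_mono ((integrable_const e).indicator hS) hRint fun p => ?_
      by_cases hp : p ∈ S
      · simp only [indicator_of_mem hp]
        exact hBe _ (hrecM _ _) hp
      · simp only [indicator_of_notMem hp]
        exact (hb p).1
    refine le_trans (le_of_eq ?_) h1
    rw [integral_prod _ ((integrable_const e).indicator hS), ← integral_const_mul]
    refine integral_congr_ae (Filter.Eventually.of_forall fun h => ?_)
    have hs : MeasurableSet {g | polrec h g ∈ B} :=
      (hrec.comp (measurable_const.prodMk measurable_id)) hB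
    have : ∀ g, S.indicator (fun _ => e) (h, g) =
      ({g | polrec h g ∈ B} : Set ℝ).indicator (fun _ => e) g := fun g => rfl
    simp only [this]
    rw [integral_indicator_const _ hs, smul_eq_mul, mul_comm]

lemma linreg {M B : Set (Fin K → ℝ)} {δ : Fin K → ℝ} {u : (Fin K → ℝ) → ℝ} {c ε x R : ℝ}
    (hc : 0 < c) (hε : 0 < ε) (hδM : δ ∈ M) (hδ : δ ∈ B) (hbd : BddAbove (u '' B))
    (hx : x ≤ sSup (u '' M) - sSup (u '' B))
    (hR : ∀ δ' ∈ M, c * (ε * (u δ' - u δ)) ≤ R) : c * ε * x ≤ R := by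
  have h1 : u δ ≤ sSup (u '' B) := le_csSup hbd ⟨δ, hδ, rfl⟩
  have hce : 0 < c * ε := mul_pos hc hε
  have h2 : sSup (u '' M) ≤ R / (c * ε) + u δ := by
    refine csSup_le ⟨_, δ, hδM, rfl⟩ ?_
    rintro _ ⟨δ', hδ', rfl⟩
    have := hR δ' hδ'
    have : u δ' - u δ ≤ R / (c * ε) := by
      rw [le_div_iff₀ hce]; linarith
    linarith
  have h3 : x ≤ R / (c * ε) := by linarith
  rw [le_div_iff₀ hce] at h3
  linarith

lemma lin_bdd {B : Set (Fin K → ℝ)} (hB : B ⊆ stdSimplex ℝ (Fin K)) {v : Fin K → ℝ}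
    (hv : ∀ i, v i ∈ Icc (-1 : ℝ) 1) : BddAbove ((fun δ => ∑ i, v i * δ i) '' B) := by
  refine ⟨1, ?_⟩
  rintro _ ⟨δ, hδ, rfl⟩
  rw [← (hB hδ).2]
  exact Finset.sum_le_sum fun i _ => mul_le_of_le_one_left ((hB hδ).1 i) (hv i).2

lemma lin_bdd' {B : Set (Fin K → ℝ)} (hB : B ⊆ stdSimplex ℝ (Fin K)) {v w : Fin K → ℝ}
    (hv : ∀ i, v i ∈ Icc (-1 : ℝ) 1) (hw : ∀ i, w i ∈ Icc (-1 : ℝ) 1) (i : Fin K) :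
    BddAbove ((fun δ => (∑ j, v j * δ j) + w i * δ i) '' B) := by
  obtain ⟨b, hb⟩ := lin_bdd hB hv
  refine ⟨b + 1, ?_⟩
  rintro _ ⟨δ, hδ, rfl⟩
  have h1 : (∑ j, v j * δ j) ≤ b := hb ⟨δ, hδ, rfl⟩
  have h2 : δ i ≤ 1 := by
    rw [← (hB hδ).2]
    exact Finset.single_le_sum (fun j _ => (hB hδ).1 j) (Finset.mem_univ i)
  have h3 : w i * δ i ≤ δ i := mul_le_of_le_one_left ((hB hδ).1 i) (hw i).2
  simp only
  linarith

lemma core_bound {a b : ℝ} {T : (ℝ → ℝ) → ℝ} {H1 H2 : ℝ → ℝ} (hc1 : IsCdfOn a b H1)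
    (hc2 : IsCdfOn a b H2) {c : ℝ} (hc : 0 < c)
    (hgrow : ∀ τ₁ τ₂ : ℝ, 0 ≤ τ₁ → τ₁ ≤ τ₂ → τ₂ ≤ 1 →
      c * (τ₂ - τ₁)
        ≤ T (fun x => τ₂ * H1 x + (1 - τ₂) * H2 x)
          - T (fun x => τ₁ * H1 x + (1 - τ₁) * H2 x))
    {n : ℕ} (hK : 2 ≤ K) (hKn : K ≤ n)
    {M : Set (Fin K → ℝ)} (hM : M ⊆ stdSimplex ℝ (Fin K))
    {pol : (t : ℕ) → (Fin t → ℝ × ℝ) → ℝ → Fin K}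
    (hpol : ∀ t, Measurable fun p : (Fin t → ℝ × ℝ) × ℝ => pol t p.1 p.2)
    {polrec : (Fin n → ℝ × ℝ) → ℝ → (Fin K → ℝ)}
    (hrec : Measurable (fun p : (Fin n → ℝ × ℝ) × ℝ => polrec p.1 p.2))
    (hrecM : ∀ h g, polrec h g ∈ M) (PG : ProbabilityMeasure ℝ)
    {A : Set (Fin K → ℝ)} (hAM : A ⊆ M) (hA : MeasurableSet A) {v w : Fin K → ℝ}
    (hv : ∀ i, v i ∈ Icc (-1 : ℝ) 1) (hw : ∀ i, w i ∈ Icc (-1 : ℝ) 1) {x S : ℝ}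
    (hx1 : x ≤ sSup ((fun δ => ∑ i, v i * δ i) '' M) - sSup ((fun δ => ∑ i, v i * δ i) '' A))
    (hx2 : ∀ i, x ≤ sSup ((fun δ => (∑ j, v j * δ j) + w i * δ i) '' M)
          - sSup ((fun δ => (∑ j, v j * δ j) + w i * δ i) '' (M \ A)))
    (hx : 0 ≤ x)
    (hS : ∀ (τ : Fin K → ℝ) (μ : Fin K → ProbabilityMeasure ℝ),
            (∀ i, τ i ∈ Set.Icc (0 : ℝ) 1) →
            (∀ (i : Fin K) (y : ℝ),
              (μ i : Measure ℝ) (Set.Iic y)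
                = ENNReal.ofReal (τ i * H1 y + (1 - τ i) * H2 y)) →
            expectedRegret n T M pol polrec
                  (fun i z => τ i * H1 z + (1 - τ i) * H2 z) μ PG ≤ S) :
    c / 64 * x * Real.sqrt (K / n) ≤ S := by
  obtain ⟨ν1, hp1, hν1⟩ := exists_measure hc1
  obtain ⟨ν2, hp2, hν2⟩ := exists_measure hc2
  have hK0 : (0 : ℝ) < K := by exact_mod_cast (by omega : 0 < K)
  have hn0 : (0 : ℝ) < n := by exact_mod_cast (by omega : 0 < n)
  have hs0 : 0 < Real.sqrt (K / n) := Real.sqrt_pos.2 (by positivity)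
  have hs1 : Real.sqrt (K / n) ≤ 1 := by
    rw [Real.sqrt_le_one, div_le_one hn0]; exact_mod_cast hKn
  have hssq : Real.sqrt (K / n) ^ 2 = K / n := Real.sq_sqrt (by positivity)
  obtain ⟨ε, hεdef⟩ : ∃ ε, ε = Real.sqrt (K / n) / 8 := ⟨_, rfl⟩
  have hε : 0 < ε := by rw [hεdef]; positivity
  have hε8 : ε ≤ 1 / 8 := by rw [hεdef]; linarith
  let τ0 : Fin K → ℝ := fun i => 1 / 2 + ε * v i
  let τ' : Fin K → Fin K → ℝ := fun i j => τ0 j + (if j = i then ε * w i else 0)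
  have hεv : ∀ i, -(1/8) ≤ ε * v i ∧ ε * v i ≤ 1 / 8 := fun i => by
    have := hv i; constructor <;> nlinarith [this.1, this.2]
  have hεw : ∀ i, -ε ≤ ε * w i ∧ ε * w i ≤ ε := fun i => by
    have := hw i; constructor <;> nlinarith [this.1, this.2]
  have hτ0a : ∀ i, 3 / 8 ≤ τ0 i := fun i => by simp only [τ0]; linarith [hεv i]
  have hτ0b : ∀ i, τ0 i ≤ 5 / 8 := fun i => by simp only [τ0]; linarith [hεv i]
  have hτd : ∀ i j, |τ' i j - τ0 j| ≤ ε := fun i j => by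
    simp only [τ', add_sub_cancel_left]
    split_ifs
    · rw [abs_le]; exact hεw i
    · simpa using hε.le
  have hτ0 : ∀ i, τ0 i ∈ Icc (0 : ℝ) 1 := fun i => ⟨by linarith [hτ0a i], by linarith [hτ0b i]⟩
  have hτ' : ∀ i j, τ' i j ∈ Icc (0 : ℝ) 1 := fun i j => by
    have := abs_le.1 (hτd i j)
    constructor <;> linarith [hτ0a j, hτ0b j]
  let μ0 : Fin K → ProbabilityMeasure ℝ := fun i => ⟨mixM ν1 ν2 (τ0 i), mixM_prob _ _ (hτ0 i)⟩
  let μ' : Fin K → Fin K → ProbabilityMeasure ℝ := fun i j =>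
    ⟨mixM ν1 ν2 (τ' i j), mixM_prob _ _ (hτ' i j)⟩
  have hP0 : ∀ δ ∈ M, ∑ j, δ j * τ0 j = 1 / 2 + ε * ∑ j, v j * δ j := fun δ hδ => by
    have : ∀ j, δ j * τ0 j = δ j * (1 / 2) + ε * (v j * δ j) := fun j => by simp only [τ0]; ring
    simp only [this, Finset.sum_add_distrib, ← Finset.sum_mul, ← Finset.mul_sum, (hM hδ).2]
    ring
  have hP' : ∀ i, ∀ δ ∈ M, ∑ j, δ j * τ' i j = 1 / 2 + ε * ((∑ j, v j * δ j) + w i * δ i) := by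
    intro i δ hδ
    have : ∀ j, δ j * τ' i j = δ j * τ0 j + (if j = i then ε * (w i * δ i) else 0) := fun j => by
      simp only [τ']; split_ifs with h
      · rw [h]; ring
      · ring
    simp only [this, Finset.sum_add_distrib, hP0 δ hδ]
    simp
    ring
  have hce : 0 ≤ c * ε * x := by positivity
  let φ : (Fin n → ℝ × ℝ) → ℝ := fun h => (PG : Measure ℝ).real {g | polrec h g ∈ A}
  have hφm : Measurable φ := by
    have : MeasurableSet {p : (Fin n → ℝ × ℝ) × ℝ | polrec p.1 p.2 ∈ A} := hrec hA
    exact (measurable_measure_prodMk_left this).ennreal_toReal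
  have hφ0 : ∀ h, 0 ≤ φ h := fun h => measureReal_nonneg
  have hφ1 : ∀ h, φ h ≤ 1 := fun h => measureReal_le_one
  have hφc : ∀ h, 1 - φ h = (PG : Measure ℝ).real {g | polrec h g ∈ Aᶜ} := fun h => by
    have hs : MeasurableSet {g | polrec h g ∈ A} :=
      (hrec.comp (measurable_const.prodMk measurable_id)) hA
    have := probReal_compl_eq_one_sub (μ := (PG : Measure ℝ)) hs
    rw [← this]; rfl
  have b0 : c * ε * x * ∫ h, φ h ∂(lawQ pol (fun i => mixM ν1 ν2 (τ0 i)) PG n) ≤ S := by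
    refine le_trans ?_ (hS τ0 μ0 hτ0 fun i y => mixM_Iic hc1 hc2 hν1 hν2 (hτ0 i) y)
    refine (expRegret_bounds hc hgrow hM hτ0 hpol hrec hrecM μ0 PG).2.2 A (c * ε * x) hA hce ?_
    intro δ hδM hδA
    refine linreg hc hε hδM hδA (lin_bdd (hAM.trans hM) hv) hx1 fun δ' hδ' => ?_
    refine le_trans (le_of_eq ?_) ((reg_bounds hc hgrow hM hτ0 hδM).2.2 δ' hδ')
    rw [hP0 δ hδM, hP0 δ' hδ']; ring
  have b1 : ∀ i, c * ε * x * ∫ h, (1 - φ h) ∂(lawQ pol (fun j => mixM ν1 ν2 (τ' i j)) PG n) ≤ S := by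
    intro i
    refine le_trans ?_ (hS (τ' i) (μ' i) (hτ' i) fun j y => mixM_Iic hc1 hc2 hν1 hν2 (hτ' i j) y)
    simp only [hφc]
    refine (expRegret_bounds hc hgrow hM (hτ' i) hpol hrec hrecM (μ' i) PG).2.2 Aᶜ
      (c * ε * x) hA.compl hce ?_
    intro δ hδM hδA
    refine linreg hc hε hδM (B := M \ A) ⟨hδM, hδA⟩ (lin_bdd' (diff_subset.trans hM) hv hw i)
      (hx2 i) fun δ' hδ' => ?_
    refine le_trans (le_of_eq ?_) ((reg_bounds hc hgrow hM (hτ' i) hδM).2.2 δ' hδ')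
    rw [hP' i δ hδM, hP' i δ' hδ']; ring
  choose r hr hr1 hr2 hrd hrl using fun i =>
    mixM_ratio ν1 ν2 (hτ0a i) (hτ0b i) (hτd i i) hε8
  have hpr0 : ∀ i, IsProbabilityMeasure (mixM ν1 ν2 (τ0 i)) := fun i => mixM_prob _ _ (hτ0 i)
  have hpr' : ∀ i j, IsProbabilityMeasure (mixM ν1 ν2 (τ' i j)) := fun i j =>
    mixM_prob _ _ (hτ' i j)
  have htp := two_point (n := n) hpol (fun i => mixM ν1 ν2 (τ0 i))
    (fun i j => mixM ν1 ν2 (τ' i j)) PG hr hr1 hr2 hrd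
    (fun i j hij => by simp [τ', hij]) (32 * ε ^ 2) hrl φ hφm hφ0 hφ1
  have hnη : n * (32 * ε ^ 2) / 2 = K / 4 := by
    rw [hεdef, div_pow, hssq]; field_simp; norm_num
  rw [hnη] at htp
  have hsum := Finset.sum_le_sum fun i (_ : i ∈ Finset.univ) => b1 i
  simp only [← Finset.mul_sum, Finset.sum_const, Finset.card_univ, Fintype.card_fin,
    nsmul_eq_mul] at hsum
  have hmul := mul_le_mul_of_nonneg_left htp hce
  have hKb0 := mul_le_mul_of_nonneg_left b0 hK0.le
  have hfin : K * (c * ε * x / 4) ≤ K * (2 * S) := by linarith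
  have hfin' := le_of_mul_le_mul_left hfin hK0
  rw [hεdef] at hfin'
  linarith

end helpers

/-- Theorem 2 of the paper (first display, eq. (12)): under Assumptions 1–4 there is a
constant `c > 0` (independent of `K`, `n` and `M_K`) such that for every closed
`M_K ⊆ S_K` with at least two elements, every policy with recommendations in `M_K` and
any randomization measure `P_G`,
`sup E[r_n(π, M_K)] ≥ c·κ(M_K)·√(K/n)` for every `n ≥ K`, the supremum being over all
potential outcome vectors with independent marginals and cdfs in `{J_τ : τ ∈ [0,1]}`. -/
theorem lower_bound_kappa
    (a b : ℝ) (hab : a < b)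
    (T : (ℝ → ℝ) → ℝ) (D : Set (ℝ → ℝ)) (hDne : D.Nonempty)
    (hDcdf : ∀ F ∈ D, IsCdfOn a b F) (hDconv : Convex ℝ D)
    (C : ℝ) (hC : 0 < C) (hLip : LipschitzAssumption a b T D C)
    (H1 H2 : ℝ → ℝ) (hH1 : H1 ∈ D) (hH2 : H2 ∈ D)
    (hJ : ∀ τ : ℝ, τ ∈ Set.Icc (0 : ℝ) 1 → (fun x => τ * H1 x + (1 - τ) * H2 x) ∈ D)
    (cminus : ℝ) (hcminus : 0 < cminus)
    (hgrow : ∀ τ₁ τ₂ : ℝ, 0 ≤ τ₁ → τ₁ ≤ τ₂ → τ₂ ≤ 1 →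
      cminus * (τ₂ - τ₁)
        ≤ T (fun x => τ₂ * H1 x + (1 - τ₂) * H2 x)
          - T (fun x => τ₁ * H1 x + (1 - τ₁) * H2 x)) :
    ∃ c : ℝ, 0 < c ∧
      ∀ (K n : ℕ), 2 ≤ K → K ≤ n →
      ∀ M : Set (Fin K → ℝ), M ⊆ stdSimplex ℝ (Fin K) → IsClosed M → M.Nontrivial →
      ∀ pol : (t : ℕ) → (Fin t → ℝ × ℝ) → ℝ → Fin K,
        (∀ t, Measurable fun p : (Fin t → ℝ × ℝ) × ℝ => pol t p.1 p.2) →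
      ∀ polrec : (Fin n → ℝ × ℝ) → ℝ → (Fin K → ℝ),
        Measurable (fun p : (Fin n → ℝ × ℝ) × ℝ => polrec p.1 p.2) →
        (∀ h g, polrec h g ∈ M) →
      ∀ PG : ProbabilityMeasure ℝ,
        c * kappa M * Real.sqrt (K / n) ≤
          sSup {x : ℝ | ∃ (τ : Fin K → ℝ) (μ : Fin K → ProbabilityMeasure ℝ),
            (∀ i, τ i ∈ Set.Icc (0 : ℝ) 1) ∧
            (∀ (i : Fin K) (y : ℝ),
              (μ i : Measure ℝ) (Set.Iic y)
                = ENNReal.ofReal (τ i * H1 y + (1 - τ i) * H2 y)) ∧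
            x = expectedRegret n T M pol polrec
                  (fun i z => τ i * H1 z + (1 - τ i) * H2 z) μ PG} := by
  refine ⟨cminus / 64, by positivity, ?_⟩
  intro K n hK hKn M hM hMc hMnt pol hpol polrec hrec hrecM PG
  have hc1 := hDcdf H1 hH1
  have hc2 := hDcdf H2 hH2
  set RS := {x : ℝ | ∃ (τ : Fin K → ℝ) (μ : Fin K → ProbabilityMeasure ℝ),
            (∀ i, τ i ∈ Set.Icc (0 : ℝ) 1) ∧
            (∀ (i : Fin K) (y : ℝ),
              (μ i : Measure ℝ) (Set.Iic y)
                = ENNReal.ofReal (τ i * H1 y + (1 - τ i) * H2 y)) ∧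
            x = expectedRegret n T M pol polrec
                  (fun i z => τ i * H1 z + (1 - τ i) * H2 z) μ PG} with hRS
  have hbdd : BddAbove RS := by
    refine ⟨T (fun x => 1 * H1 x + (1 - 1) * H2 x) - T (fun x => 0 * H1 x + (1 - 0) * H2 x), ?_⟩
    rintro _ ⟨τ, μ, hτ, -, rfl⟩
    exact (expRegret_bounds hcminus hgrow hM hτ hpol hrec hrecM μ PG).2.1
  have hS : ∀ (τ : Fin K → ℝ) (μ : Fin K → ProbabilityMeasure ℝ),
            (∀ i, τ i ∈ Set.Icc (0 : ℝ) 1) →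
            (∀ (i : Fin K) (y : ℝ),
              (μ i : Measure ℝ) (Set.Iic y)
                = ENNReal.ofReal (τ i * H1 y + (1 - τ i) * H2 y)) →
            expectedRegret n T M pol polrec
                  (fun i z => τ i * H1 z + (1 - τ i) * H2 z) μ PG ≤ sSup RS :=
    fun τ μ h1 h2 => le_csSup hbdd ⟨τ, μ, h1, h2, rfl⟩
  have hS0 : 0 ≤ sSup RS := by
    refine Real.sSup_nonneg ?_
    rintro _ ⟨τ, μ, hτ, -, rfl⟩
    exact (expRegret_bounds hcminus hgrow hM hτ hpol hrec hrecM μ PG).1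
  have hK0 : (0 : ℝ) < K := by exact_mod_cast (by omega : 0 < K)
  have hn0 : (0 : ℝ) < n := by exact_mod_cast (by omega : 0 < n)
  have hs0 : 0 < Real.sqrt (K / n) := Real.sqrt_pos.2 (by positivity)
  have hpos : 0 < cminus / 64 * Real.sqrt (K / n) := by positivity
  have hk : kappa M ≤ sSup RS / (cminus / 64 * Real.sqrt (K / n)) := by
    refine Real.sSup_le ?_ (by positivity)
    rintro x ⟨A, v, w, hAne, hAM, hA, hv, hw, hx⟩
    rw [le_div_iff₀ hpos]
    rcases le_total x 0 with h | h
    · exact le_trans (mul_nonpos_of_nonpos_of_nonneg h hpos.le) hS0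
    · have hx1 := hx.le.trans (min_le_left _ _)
      have hx2 : ∀ i, _ := fun i => (hx.le.trans (min_le_right _ _)).trans
        (ciInf_le (Set.finite_range _).bddBelow i)
      have := core_bound hc1 hc2 hcminus hgrow hK hKn hM hpol hrec hrecM PG hAM.subset hA hv hw
        hx1 hx2 h hS
      linarith
  rw [le_div_iff₀ hpos] at hk
  linarith

end TRDT
end
end

section
/- Let K ≥ 2 and let M_K ⊆ S_K be closed with at least two elements. Then κ(M_K) ≥ (1/272) · max_{δ∈M_K} ‖δ‖² · min_{j=1,…,K} ( max_{δ∈M_K} δ_j − min_{δ∈M_K} δ_j )³, where ‖·‖ is the Euclidean norm. -/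
open MeasureTheory Set

noncomputable section

namespace TRDT

lemma abs_lin_le {K : ℕ} {v δ : Fin K → ℝ} (hv : ∀ i, v i ∈ Set.Icc (-1 : ℝ) 1)
    (hδ : δ ∈ stdSimplex ℝ (Fin K)) : |∑ i, v i * δ i| ≤ 1 := by
  calc |∑ i, v i * δ i| ≤ ∑ i, |v i * δ i| := Finset.abs_sum_le_sum_abs _ _
    _ ≤ ∑ i, δ i := by
      apply Finset.sum_le_sum
      intro i _
      rw [abs_mul, abs_of_nonneg (hδ.1 i)]
      have := abs_le.2 (hv i)
      nlinarith [hδ.1 i]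
    _ = 1 := hδ.2

lemma kappa_bdd {K : ℕ} {M : Set (Fin K → ℝ)} (hMsub : M ⊆ stdSimplex ℝ (Fin K)) :
    BddAbove {x : ℝ | ∃ (T : Set (Fin K → ℝ)) (v w : Fin K → ℝ),
    T.Nonempty ∧ T ⊂ M ∧ MeasurableSet T ∧
    (∀ i, v i ∈ Set.Icc (-1 : ℝ) 1) ∧ (∀ i, w i ∈ Set.Icc (-1 : ℝ) 1) ∧
    x = min
      (sSup ((fun δ => ∑ i, v i * δ i) '' M) - sSup ((fun δ => ∑ i, v i * δ i) '' T))
      (⨅ i : Fin K,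
        (sSup ((fun δ => (∑ j, v j * δ j) + w i * δ i) '' M)
          - sSup ((fun δ => (∑ j, v j * δ j) + w i * δ i) '' (M \ T))))} := by
  refine ⟨2, ?_⟩
  rintro x ⟨T, v, w, hT, hTM, -, hv, -, rfl⟩
  refine (min_le_left _ _).trans ?_
  obtain ⟨t, ht⟩ := hT
  have h1 : sSup ((fun δ => ∑ i, v i * δ i) '' M) ≤ 1 := by
    apply csSup_le ⟨_, mem_image_of_mem _ (hTM.1 ht)⟩
    rintro _ ⟨δ, hδ, rfl⟩
    exact (abs_le.1 (abs_lin_le hv (hMsub hδ))).2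
  have h2 : -1 ≤ sSup ((fun δ => ∑ i, v i * δ i) '' T) := by
    refine (abs_le.1 (abs_lin_le hv (hMsub (hTM.1 ht)))).1.trans ?_
    apply le_csSup _ (mem_image_of_mem (fun δ => ∑ i, v i * δ i) ht)
    refine ⟨1, ?_⟩
    rintro _ ⟨δ, hδ, rfl⟩
    exact (abs_le.1 (abs_lin_le hv (hMsub (hTM.1 hδ)))).2
  linarith

lemma kappa_ge {K : ℕ} (hK : 2 ≤ K) {M : Set (Fin K → ℝ)} (hMsub : M ⊆ stdSimplex ℝ (Fin K))
    (hMc : IsCompact M) (T : Set (Fin K → ℝ)) (v w : Fin K → ℝ) (η : ℝ)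
    (hT : T.Nonempty) (hTM : T ⊂ M) (hTm : MeasurableSet T)
    (hv : ∀ i, v i ∈ Set.Icc (-1 : ℝ) 1) (hw : ∀ i, w i ∈ Set.Icc (-1 : ℝ) 1)
    (h1 : ∃ d ∈ M, ∀ t ∈ T, ∑ i, v i * t i + η ≤ ∑ i, v i * d i)
    (h2 : ∀ i, ∃ d ∈ M, ∀ t ∈ M \ T,
      (∑ j, v j * t j) + w i * t i + η ≤ (∑ j, v j * d j) + w i * d i) :
    η ≤ kappa M := by
  have : Nonempty (Fin K) := ⟨⟨0, by omega⟩⟩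
  unfold kappa
  refine le_trans ?_ (le_csSup (kappa_bdd hMsub) ⟨T, v, w, hT, hTM, hTm, hv, hw, rfl⟩)
  have key : ∀ (f : (Fin K → ℝ) → ℝ) (S : Set (Fin K → ℝ)), Continuous f → S.Nonempty →
      (∃ d ∈ M, ∀ t ∈ S, f t + η ≤ f d) → η ≤ sSup (f '' M) - sSup (f '' S) := by
    rintro f S hf hS ⟨d, hd, h⟩
    have a1 : f d ≤ sSup (f '' M) :=
      le_csSup (hMc.bddAbove_image hf.continuousOn) (mem_image_of_mem _ hd)
    have a2 : sSup (f '' S) ≤ f d - η := by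
      apply csSup_le (hS.image _)
      rintro _ ⟨t, ht, rfl⟩
      linarith [h t ht]
    linarith
  apply le_min
  · exact key _ T (by fun_prop) hT h1
  · apply le_ciInf
    intro i
    exact key _ (M \ T) (by fun_prop) (nonempty_of_ssubset hTM) (h2 i)

/-- Theorem 2 (second display, eq. (13)): for closed `M_K ⊆ S_K` with at least two elements,
`κ(M_K) ≥ (1/272) · max_{δ∈M_K} ‖δ‖² · min_j (max_{δ∈M_K} δ_j − min_{δ∈M_K} δ_j)³`. -/
theorem kappa_ge_inv272_mul_maxNormSq_mul_minOscCubed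
    (K : ℕ) (hK : 2 ≤ K) (M : Set (Fin K → ℝ))
    (hMsub : M ⊆ stdSimplex ℝ (Fin K)) (hMclosed : IsClosed M) (hM2 : M.Nontrivial) :
    (1 / 272) * sSup ((fun δ => ∑ i, (δ i) ^ 2) '' M)
        * (⨅ j : Fin K, (sSup ((fun δ => δ j) '' M) - sInf ((fun δ => δ j) '' M)) ^ 3)
      ≤ kappa M := by
  have : Nonempty (Fin K) := ⟨⟨0, by omega⟩⟩
  have hMc : IsCompact M := (isCompact_stdSimplex ℝ (Fin K)).of_isClosed_subset hMclosed hMsub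
  have hMne : M.Nonempty := hM2.nonempty
  obtain ⟨d, hd, hdmax⟩ := hMc.exists_isMaxOn hMne
    (f := fun δ : Fin K → ℝ => ∑ i, (δ i) ^ 2) (by fun_prop)
  have hdmax' : ∀ δ ∈ M, ∑ i, (δ i) ^ 2 ≤ ∑ i, (d i) ^ 2 := fun δ hδ => hdmax hδ
  obtain ⟨N, hN⟩ : ∃ N, N = ∑ i, (d i) ^ 2 := ⟨_, rfl⟩
  have hNsup : sSup ((fun δ : Fin K → ℝ => ∑ i, (δ i) ^ 2) '' M) = N := by
    apply le_antisymm
    · apply csSup_le (hMne.image _)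
      rintro _ ⟨δ, hδ, rfl⟩
      rw [hN]; exact hdmax' δ hδ
    · rw [hN]
      exact le_csSup (hMc.bddAbove_image (by fun_prop)) (mem_image_of_mem (fun δ : Fin K → ℝ => ∑ i, (δ i) ^ 2) hd)
  rw [← hN] at hdmax'
  rw [hNsup]
  have hnn : ∀ δ ∈ M, ∀ i, 0 ≤ δ i := fun δ hδ i => (hMsub hδ).1 i
  have hle1 : ∀ δ ∈ M, ∀ i, δ i ≤ 1 := fun δ hδ i => by
    rw [← (hMsub hδ).2]
    exact Finset.single_le_sum (f := δ) (fun j _ => hnn δ hδ j) (Finset.mem_univ i)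
  have hsqN : ∀ δ ∈ M, ∀ i, δ i ^ 2 ≤ N := fun δ hδ i =>
    (Finset.single_le_sum (f := fun j => δ j ^ 2) (fun j _ => sq_nonneg _)
      (Finset.mem_univ i)).trans (hdmax' δ hδ)
  have hN0 : 0 ≤ N := by rw [hN]; positivity
  have hN1 : N ≤ 1 := by
    rw [hN, ← (hMsub hd).2]
    apply Finset.sum_le_sum
    intro i _
    nlinarith [hnn d hd i, hle1 d hd i]
  obtain ⟨j0, hj0⟩ := Finite.exists_min
    (fun j : Fin K => sSup ((fun δ : Fin K → ℝ => δ j) '' M) - sInf ((fun δ : Fin K → ℝ => δ j) '' M))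
  obtain ⟨c, hc⟩ : ∃ c, c = sSup ((fun δ : Fin K → ℝ => δ j0) '' M) - sInf ((fun δ : Fin K → ℝ => δ j0) '' M) := ⟨_, rfl⟩
  have hinf : (⨅ j : Fin K, (sSup ((fun δ => δ j) '' M) - sInf ((fun δ => δ j) '' M)) ^ 3) ≤ c ^ 3 := by
    rw [hc]
    exact ciInf_le (Set.finite_range _).bddBelow j0
  rw [← hc] at hj0
  -- far points
  have hfar : ∀ i, ∃ e ∈ M, c / 2 ≤ |e i - d i| := by
    intro i
    have hcont : ContinuousOn (fun δ : Fin K → ℝ => δ i) M := by fun_prop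
    obtain ⟨a, ha, ha'⟩ := hMc.exists_sSup_image_eq hMne hcont
    obtain ⟨b, hb, hb'⟩ := hMc.exists_sInf_image_eq hMne hcont
    have hci := hj0 i
    beta_reduce at hci
    rw [ha', hb'] at hci
    by_contra! hcon
    have h1 := (abs_lt.1 (hcon a ha)).2
    have h2 := (abs_lt.1 (hcon b hb)).1
    linarith
  have hRHS : (1 / 272) * N * (⨅ j : Fin K, (sSup ((fun δ => δ j) '' M) - sInf ((fun δ => δ j) '' M)) ^ 3)
      ≤ (1 / 272) * N * c ^ 3 := by
    apply mul_le_mul_of_nonneg_left hinf; positivity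
  refine hRHS.trans ?_
  rcases le_or_gt c 0 with hc0 | hc0
  · have h0 : (0:ℝ) ≤ kappa M := by
      obtain ⟨a, ha, b, hb, hab⟩ := hM2
      refine kappa_ge hK hMsub hMc {a} 0 0 0 (singleton_nonempty a) ?_ (measurableSet_singleton a)
        (by simp) (by simp) ⟨a, ha, by simp⟩ (fun i => ⟨a, ha, by simp⟩)
      refine ⟨by simpa using ha, fun h => hab ?_⟩
      exact (h hb).symm
    refine le_trans ?_ h0
    have : c ^ 3 ≤ 0 := by nlinarith [sq_nonneg c]
    nlinarith
  choose e he hce using hfar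
  have hNpos : 0 < N := by
    by_contra! hcon
    have h1 := hsqN (e j0) (he j0) j0
    have h2 := hsqN d hd j0
    have h3 : (e j0 j0) = 0 := by nlinarith
    have h4 : d j0 = 0 := by nlinarith
    have := hce j0
    rw [h3, h4] at this
    simp at this
    linarith
  have hc1 : c ≤ 2 * 1 := by
    have h := hce j0
    have : |e j0 j0 - d j0| ≤ 1 := by
      rw [abs_le]
      constructor <;> linarith [hnn d hd j0, hle1 d hd j0, hnn _ (he j0) j0, hle1 _ (he j0) j0]
    linarith
  have hc1 : c ≤ 1 := by
    obtain ⟨a, ha, ha'⟩ := hMc.exists_sSup_image_eq (f := fun δ : Fin K → ℝ => δ j0) hMne (by fun_prop)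
    obtain ⟨b, hb, hb'⟩ := hMc.exists_sInf_image_eq (f := fun δ : Fin K → ℝ => δ j0) hMne (by fun_prop)
    rw [hc, ha', hb']
    linarith [hle1 a ha j0, hnn b hb j0]
  have hcN : c ^ 2 / 4 ≤ N := by
    have h := hce j0
    have h1 := hsqN (e j0) (he j0) j0
    have h2 := hsqN d hd j0
    have p1 := hnn _ (he j0) j0
    have p2 := hnn d hd j0
    have h3 : (c / 2) ^ 2 ≤ (e j0 j0 - d j0) ^ 2 := by
      rw [← sq_abs (e j0 j0 - d j0)]
      exact pow_le_pow_left₀ (by linarith) h 2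
    rcases le_total (e j0 j0) (d j0) with h4 | h4 <;> nlinarith
  obtain ⟨s, hs⟩ : ∃ s, s = c / (4 * N) := ⟨_, rfl⟩
  have hs0 : 0 < s := by rw [hs]; positivity
  have hsN : s * N = c / 4 := by rw [hs]; field_simp
  obtain ⟨η, hη⟩ : ∃ η, η = (1 / 272) * N * c ^ 3 := ⟨_, rfl⟩
  rw [← hη]
  have hη0 : 0 < η := by rw [hη]; positivity
  have hc3 : c ^ 3 ≤ c := by nlinarith [mul_pos hc0 hc0]
  have hηc : η ≤ c / 272 := by
    rw [hη]; nlinarith [pow_pos hc0 3]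
  -- 2 η ≤ s * (c/5)^2
  have hη2 : 2 * η ≤ s * (c / 5) ^ 2 := by
    have : N ^ 2 * c ^ 3 ≤ c ^ 3 := by
      have : N ^ 2 ≤ 1 := by nlinarith
      nlinarith [pow_pos hc0 3]
    have h2 : N * (2 * η) ≤ N * (s * (c / 5) ^ 2) := by
      have : N * (s * (c / 5) ^ 2) = c ^ 3 / 100 := by
        rw [← mul_assoc, mul_comm N s, hsN]; ring
      rw [this, hη]
      nlinarith
    exact le_of_mul_le_mul_left h2 hNpos
  -- strong concavity
  have hval : ∑ i, (s * d i) * d i = c / 4 := by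
    rw [← hsN, hN, Finset.mul_sum]
    exact Finset.sum_congr rfl fun i _ => by ring
  have hstrong : ∀ δ ∈ M, ∀ i, s / 2 * (δ i - d i) ^ 2 ≤ c / 4 - ∑ i, (s * d i) * δ i := by
    intro δ hδ i
    have h1 : (δ i - d i) ^ 2 ≤ ∑ j, (δ j - d j) ^ 2 :=
      Finset.single_le_sum (f := fun j => (δ j - d j) ^ 2) (fun j _ => sq_nonneg _)
        (Finset.mem_univ i)
    have h2 : s / 2 * ∑ j, (δ j - d j) ^ 2
        = s / 2 * (∑ j, δ j ^ 2) + s / 2 * (∑ j, d j ^ 2) - ∑ j, (s * d j) * δ j := by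
      simp only [Finset.mul_sum]
      rw [← Finset.sum_add_distrib, ← Finset.sum_sub_distrib]
      exact Finset.sum_congr rfl fun i _ => by ring
    rw [← hN] at h2
    have h3 := hdmax' δ hδ
    nlinarith
  have hnonneg : ∀ δ ∈ M, 0 ≤ ∑ i, (s * d i) * δ i := fun δ hδ =>
    Finset.sum_nonneg fun i _ => mul_nonneg (mul_nonneg hs0.le (hnn d hd i)) (hnn δ hδ i)
  have hcontv : Continuous (fun δ : Fin K → ℝ => ∑ i, (s * d i) * δ i) := by fun_prop
  refine kappa_ge hK hMsub hMc (M ∩ {δ | ∑ i, (s * d i) * δ i ≤ c / 4 - η}) (fun i => s * d i)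
    (fun i => if d i ≤ e i i then 1 else -1) η ?_ ?_ ?_ ?_ ?_ ?_ ?_
  · refine ⟨e j0, he j0, ?_⟩
    have h1 := hstrong _ (he j0) j0
    have h3 : (c / 2) ^ 2 ≤ (e j0 j0 - d j0) ^ 2 := by
      rw [← sq_abs (e j0 j0 - d j0)]
      exact pow_le_pow_left₀ (by linarith) (hce j0) 2
    have h4 : (c / 5) ^ 2 ≤ (c / 2) ^ 2 := pow_le_pow_left₀ (by linarith) (by linarith) 2
    have h5 : s / 2 * (c / 5) ^ 2 ≤ s / 2 * (e j0 j0 - d j0) ^ 2 :=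
      mul_le_mul_of_nonneg_left (h4.trans h3) (by linarith)
    rw [mem_ofPred_eq]
    linarith
  · refine ⟨inter_subset_left, fun h => ?_⟩
    have := (h hd).2
    simp only [mem_ofPred_eq, hval] at this
    linarith
  · exact hMclosed.measurableSet.inter (isClosed_le hcontv continuous_const).measurableSet
  · intro i
    have h1 := hnn d hd i
    have h2 := hsqN d hd i
    refine ⟨by nlinarith, ?_⟩
    rw [hs, div_mul_eq_mul_div, div_le_one (by positivity)]
    nlinarith [sq_nonneg (c / 2 - d i)]
  · intro i
    split_ifs <;> norm_num
  · refine ⟨d, hd, fun t ht => ?_⟩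
    have := ht.2
    simp only [mem_ofPred_eq] at this
    rw [hval]; linarith
  · intro i
    refine ⟨e i, he i, fun t ht => ?_⟩
    obtain ⟨htM, htT⟩ := ht
    have hlt : c / 4 - η < ∑ i, (s * d i) * t i := by
      by_contra! hcon
      exact htT ⟨htM, hcon⟩
    have h1 := hstrong t htM i
    have h0 : 0 ≤ s / 2 * (t i - d i) ^ 2 := by positivity
    have h2 : s * (t i - d i) ^ 2 ≤ s * (c / 5) ^ 2 := by linarith
    have h3 := abs_le_of_sq_le_sq' (le_of_mul_le_mul_left h2 hs0) (by linarith)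
    have h4 := hnonneg _ (he i)
    have h5 := hce i
    obtain ⟨h3a, h3b⟩ := h3
    split_ifs with hif
    · rw [abs_of_nonneg (by linarith)] at h5
      linarith
    · rw [abs_of_neg (by linarith)] at h5
      linarith

end TRDT
end
end

section
/- Let K ≥ 2 and let M_K ⊆ S_K be closed with at least two elements. Then κ(M_K) ≥ ( (min_{j=1,…,K} max_{δ∈M_K} δ_j) − 1/2 )₊², where (x)₊ := max(x,0) denotes the positive part. -/
open MeasureTheory Set

noncomputable section

namespace TRDT

theorem gap_aux {K : ℕ} {M S : Set (Fin K → ℝ)} (hM : IsCompact M) (f : (Fin K → ℝ) → ℝ)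
    (hf : Continuous f) (hS : S.Nonempty) (x : Fin K → ℝ) (hx : x ∈ M) (c g : ℝ)
    (hc : ∀ y ∈ S, f y ≤ c) (hg : c + g ≤ f x) :
    g ≤ sSup (f '' M) - sSup (f '' S) := by
  have h1 : f x ≤ sSup (f '' M) :=
    le_csSup (hM.image hf).bddAbove (mem_image_of_mem f hx)
  have h2 : sSup (f '' S) ≤ c := csSup_le (hS.image f) (by rintro _ ⟨y, hy, rfl⟩; exact hc y hy)
  linarith

theorem abs_aux {K : ℕ} {v δ : Fin K → ℝ} (hv : ∀ i, v i ∈ Set.Icc (-1 : ℝ) 1)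
    (hδ : δ ∈ stdSimplex ℝ (Fin K)) : -1 ≤ ∑ i, v i * δ i ∧ ∑ i, v i * δ i ≤ 1 := by
  obtain ⟨h0, h1⟩ := hδ
  constructor
  · calc (-1 : ℝ) = ∑ i, -1 * δ i := by rw [← Finset.mul_sum, h1]; norm_num
      _ ≤ _ := Finset.sum_le_sum fun i _ => mul_le_mul_of_nonneg_right (hv i).1 (h0 i)
  · calc ∑ i, v i * δ i ≤ ∑ i, 1 * δ i :=
        Finset.sum_le_sum fun i _ => mul_le_mul_of_nonneg_right (hv i).2 (h0 i)
      _ = 1 := by rw [← Finset.mul_sum, h1]; norm_num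

theorem pair_aux {K : ℕ} {δ : Fin K → ℝ} (hδ : δ ∈ stdSimplex ℝ (Fin K)) {i j : Fin K}
    (hij : i ≠ j) : δ i + δ j ≤ 1 := by
  obtain ⟨h0, h1⟩ := hδ
  rw [← h1, ← Finset.sum_pair hij]
  exact Finset.sum_le_sum_of_subset_of_nonneg (Finset.subset_univ _) fun k _ _ => h0 k

/-- Theorem 2 (last claim): for closed `M_K ⊆ S_K` with at least two elements,
`κ(M_K)` is lower bounded by the squared positive part of
`min_j max_{δ∈M_K} δ_j − 1/2`. -/
theorem kappa_ge_posPart_sq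
    (K : ℕ) (hK : 2 ≤ K) (M : Set (Fin K → ℝ))
    (hMsub : M ⊆ stdSimplex ℝ (Fin K)) (hMclosed : IsClosed M) (hM2 : M.Nontrivial) :
    (max ((⨅ j : Fin K, sSup ((fun δ => δ j) '' M)) - 1 / 2) 0) ^ 2 ≤ kappa M := by
  have hMc : IsCompact M := (isCompact_stdSimplex ℝ (Fin K)).of_isClosed_subset hMclosed hMsub
  have hne : M.Nonempty := hM2.nonempty
  let o : Fin K := ⟨0, by omega⟩
  let p : Fin K := ⟨1, by omega⟩
  have hop : o ≠ p := by simp [o, p]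
  have : Nonempty (Fin K) := ⟨o⟩
  have key : ∀ g : ℝ, ∀ (T : Set (Fin K → ℝ)) (v w : Fin K → ℝ),
      T.Nonempty → T ⊂ M → MeasurableSet T →
      (∀ i, v i ∈ Set.Icc (-1 : ℝ) 1) → (∀ i, w i ∈ Set.Icc (-1 : ℝ) 1) →
      g ≤ sSup ((fun δ => ∑ i, v i * δ i) '' M) - sSup ((fun δ => ∑ i, v i * δ i) '' T) →
      (∀ i, g ≤ sSup ((fun δ => (∑ j, v j * δ j) + w i * δ i) '' M)
          - sSup ((fun δ => (∑ j, v j * δ j) + w i * δ i) '' (M \ T))) → g ≤ kappa M := by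
    intro g T v w h1 h2 h3 h4 h5 h6 h7
    refine le_trans (le_min h6 (le_ciInf h7)) ?_
    unfold kappa
    refine le_csSup ?_ ⟨T, v, w, h1, h2, h3, h4, h5, rfl⟩
    refine ⟨2, ?_⟩
    rintro _ ⟨T, v, w, hT, hTM, -, hv, -, rfl⟩
    refine (min_le_left _ _).trans ?_
    have e1 : sSup ((fun δ => ∑ i, v i * δ i) '' M) ≤ 1 :=
      csSup_le (hne.image _) (by rintro _ ⟨y, hy, rfl⟩; exact (abs_aux hv (hMsub hy)).2)
    obtain ⟨t, ht⟩ := hT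
    have e2 : ∑ i, v i * t i ≤ sSup ((fun δ => ∑ i, v i * δ i) '' T) := by
      refine le_csSup ⟨1, ?_⟩ ⟨t, ht, rfl⟩
      rintro _ ⟨y, hy, rfl⟩
      exact (abs_aux hv (hMsub (hTM.1 hy))).2
    have e3 := (abs_aux hv (hMsub (hTM.1 ht))).1
    linarith
  set m := ⨅ j : Fin K, sSup ((fun δ : Fin K → ℝ => δ j) '' M) with hm
  have hex : ∀ j, ∃ x ∈ M, m ≤ x j := by
    intro j
    obtain ⟨x, hx, hxe⟩ := (hMc.image (continuous_apply j)).sSup_mem (hne.image _)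
    refine ⟨x, hx, ?_⟩
    change x j = _ at hxe
    rw [hxe]
    exact ciInf_le (Set.finite_range _).bddBelow j
  rcases le_or_gt m (1/2) with hle | hgt
  · rw [max_eq_right (by linarith)]
    obtain ⟨x, hx, y, hy, hxy⟩ := hM2
    refine key _ {x} 0 0 (singleton_nonempty x) ?_ (measurableSet_singleton x) (by simp) (by simp)
      ?_ ?_
    · refine ⟨by simpa using hx, fun h => hxy ?_⟩
      exact (h hy).symm
    · exact gap_aux hMc _ (by fun_prop) (singleton_nonempty x) x hx 0 _ (by simp) (by simp)
    · intro i
      have hDne : (M \ {x}).Nonempty := ⟨y, hy, fun h => hxy h.symm⟩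
      exact gap_aux hMc _ (by fun_prop) hDne x hx 0 _ (by simp) (by simp)
  rw [max_eq_left (by linarith)]
  obtain ⟨a, ha⟩ : ∃ a, a = m - 1/2 := ⟨_, rfl⟩
  rw [← ha]
  obtain ⟨x0, hx0, hx0m⟩ := hex o
  obtain ⟨x1, hx1, hx1m⟩ := hex p
  have hx0l : x0 o + x0 p ≤ 1 := pair_aux (hMsub hx0) hop
  have hx0n : 0 ≤ x0 p := (hMsub hx0).1 p
  have hx1l : x1 o + x1 p ≤ 1 := pair_aux (hMsub hx1) hop
  have ha0 : 0 < a := by linarith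
  have ha1 : a ≤ 1/2 := by linarith
  have hsum : ∀ δ : Fin K → ℝ, ∑ i, (Pi.single o a : Fin K → ℝ) i * δ i = a * δ o := by
    intro δ
    rw [Finset.sum_eq_single o]
    · simp
    · intro b _ hb; simp [Pi.single_eq_of_ne hb]
    · simp
  have hclosed : IsClosed (M ∩ {δ | δ o ≤ 1/2}) :=
    hMclosed.inter (isClosed_le (continuous_apply o) continuous_const)
  have hTne : (M ∩ {δ | δ o ≤ 1/2}).Nonempty := ⟨x1, hx1, by simp only [mem_ofPred_eq]; linarith⟩
  have hx0T : x0 ∉ M ∩ {δ | δ o ≤ 1/2} := by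
    rintro ⟨-, h⟩
    simp only [mem_ofPred_eq] at h
    linarith
  refine key _ (M ∩ {δ | δ o ≤ 1/2}) (Pi.single o a) (fun i => if i = o then -1 else 1)
    hTne ⟨inter_subset_left, fun h => hx0T (h hx0)⟩ hclosed.measurableSet ?_ ?_ ?_ ?_
  · intro i
    by_cases h : i = o
    · subst h; simp only [Pi.single_eq_same]; constructor <;> linarith
    · simp [Pi.single_eq_of_ne h]
  · intro i
    split_ifs <;> norm_num
  · simp only [hsum]
    refine gap_aux hMc _ (by fun_prop) hTne x0 hx0 (a * (1/2)) _ ?_ ?_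
    · rintro y ⟨-, hy⟩
      exact mul_le_mul_of_nonneg_left hy ha0.le
    · nlinarith
  · intro i
    simp only [hsum]
    have hDne : (M \ (M ∩ {δ | δ o ≤ 1/2})).Nonempty := ⟨x0, hx0, hx0T⟩
    have hout : ∀ y ∈ M \ (M ∩ {δ | δ o ≤ 1/2}), y ∈ M ∧ 1/2 < y o := by
      rintro y ⟨hy, hy'⟩
      refine ⟨hy, ?_⟩
      by_contra h
      exact hy' ⟨hy, not_lt.mp h⟩
    by_cases h : i = o
    · subst h
      rw [if_pos rfl]
      refine gap_aux hMc _ (by fun_prop) hDne x1 hx1 (-(1-a)*(1/2)) _ ?_ ?_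
      · intro y hy
        have := (hout y hy).2
        nlinarith
      · nlinarith
    · rw [if_neg h]
      obtain ⟨z, hz, hzm⟩ := hex i
      have hz0 := (hMsub hz).1 o
      refine gap_aux hMc _ (by fun_prop) hDne z hz (1-(1-a)*(1/2)) _ ?_ ?_
      · intro y hy
        have h1 := (hout y hy).2
        have h2 := pair_aux (hMsub (hout y hy).1) h
        nlinarith
      · nlinarith

end TRDT
end
end
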